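/- Fix q ∈ (0,1/2) and a > 0 with a√β ≥ 2. There exists a constant C > 0, independent of ε and n, such that for every ε ∈ (0,1] with aε < q and every integer n ≥ 2, the solution u of the continuous linear problem and the unique solution y of the discrete scheme on the Vulanović mesh satisfy max_{0≤i≤n} |u(x_i) − y_i| ≤ C n^{−2}. -/

import Mathlib

open Set Real

noncomputable section

/-- first partial derivative of `f(x,u)` with respect to `u` -/
def pderiv1 (f : ℝ → ℝ → ℝ) (x y : ℝ) : ℝ := deriv (fun z => f x z) y

/-- second partial derivative of `f(x,u)` with respect to `u` -/
def pderiv2 (f : ℝ → ℝ → ℝ) (x y : ℝ) : ℝ :=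
  deriv (fun z => deriv (fun w => f x w) z) y

/-- `f` is four times continuously differentiable on `[0,1] × ℝ`. -/
def SmoothF (f : ℝ → ℝ → ℝ) : Prop :=
  ContDiffOn ℝ 4 (fun p : ℝ × ℝ => f p.1 p.2) ((Icc (0:ℝ) 1) ×ˢ (univ : Set ℝ))

/-- the stability condition `f_u(x,u) ≥ c₀² > 0` on `[0,1] × ℝ` -/
def LowerF (f : ℝ → ℝ → ℝ) (c₀ : ℝ) : Prop :=
  ∀ x ∈ Icc (0:ℝ) 1, ∀ y : ℝ, c₀ ^ 2 ≤ pderiv1 f x y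

/-- `u` is a C⁴-solution of the semilinear BVP `-ε²u'' + f(x,u) = 0`, `u(0)=u(1)=0`. -/
def IsSolution (f : ℝ → ℝ → ℝ) (ε : ℝ) (u : ℝ → ℝ) : Prop :=
  ContDiffOn ℝ 4 u (Icc (0:ℝ) 1) ∧
  (∀ x ∈ Ioo (0:ℝ) 1,
    -ε ^ 2 * iteratedDerivWithin 2 u (Icc (0:ℝ) 1) x + f x (u x) = 0) ∧
  u 0 = 0 ∧ u 1 = 0

/-- the constant `l = c₀⁻² · max_{[0,1]} |f(x,0)|` -/
def lconst (f : ℝ → ℝ → ℝ) (c₀ : ℝ) : ℝ :=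
  c₀ ^ (-2 : ℤ) * sSup ((fun x => |f x 0|) '' Icc (0:ℝ) 1)

/-- the constant `θ = max { |f_uu(x,ξ)| : x ∈ [0,1], |ξ| ≤ l + 2ρ }` -/
def thconst (f : ℝ → ℝ → ℝ) (c₀ ρ : ℝ) : ℝ :=
  sSup ((fun p : ℝ × ℝ => |pderiv2 f p.1 p.2|) ''
    ((Icc (0:ℝ) 1) ×ˢ (Icc (-(lconst f c₀ + 2*ρ)) (lconst f c₀ + 2*ρ))))

/-- discrete second difference `y_{x̄x̂,i}` on a nonuniform mesh `x` (for `1 ≤ i`),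
using `ℏ_i = (h_i + h_{i+1})/2 = (x_{i+1} - x_{i-1})/2`. -/
def ddiff (x y : ℕ → ℝ) (i : ℕ) : ℝ :=
  2 / (x (i+1) - x (i-1)) *
    ((y (i+1) - y i) / (x (i+1) - x i) - (y i - y (i-1)) / (x i - x (i-1)))

/-- Shishkin mesh generating function with transition parameter
`α = min(1/4, 2γ₀⁻¹ ε ln n)`. -/
def shishkinLam (γ₀ ε : ℝ) (n : ℕ) (t : ℝ) : ℝ :=
  let α := min (1/4) (2 * γ₀⁻¹ * ε * Real.log n)
  if t ≤ 1/4 then 4*α*t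
  else if t ≤ 1/2 then α + 2*(1-2*α)*(t-1/4)
  else 1 - (if 1-t ≤ 1/4 then 4*α*(1-t) else α + 2*(1-2*α)*((1-t)-1/4))

/-- Shishkin mesh nodes `x_i = λ(i/n)` -/
def shishkinMesh (γ₀ ε : ℝ) (n i : ℕ) : ℝ := shishkinLam γ₀ ε n ((i:ℝ)/(n:ℝ))

def bakhPhi (a ε q t : ℝ) : ℝ := a*ε*Real.log (q/(q-t))

/-- derivative of `bakhPhi` -/
def bakhPhi' (a ε q t : ℝ) : ℝ := a*ε/(q-t)

/-- `α ∈ (0,q)` is the abscissa of the contact point of the tangent line from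
`(1/2,1/2)` to `φ`, i.e. `φ(α) + φ'(α)(1/2 - α) = 1/2`. -/
def IsBakhAlpha (a ε q α : ℝ) : Prop :=
  α ∈ Ioo 0 q ∧ bakhPhi a ε q α + bakhPhi' a ε q α * (1/2 - α) = 1/2

/-- Bakhvalov mesh generating function -/
def bakhLam (a ε q α t : ℝ) : ℝ :=
  if t ≤ α then bakhPhi a ε q t
  else if t ≤ 1/2 then bakhPhi a ε q α + bakhPhi' a ε q α * (t-α)
  else 1 - (if 1-t ≤ α then bakhPhi a ε q (1-t)
            else bakhPhi a ε q α + bakhPhi' a ε q α * ((1-t)-α))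

/-- Bakhvalov mesh nodes `x_i = λ(i/n)` -/
def bakhMesh (a ε q α : ℝ) (n i : ℕ) : ℝ := bakhLam a ε q α ((i:ℝ)/(n:ℝ))

def vulAlpha (a ε q : ℝ) : ℝ :=
  (q - Real.sqrt (ε*a*q*(1-2*q+2*ε*a)))/(1+2*ε*a)

def vulMu (a ε q t : ℝ) : ℝ := a*ε*t/(q-t)

/-- derivative of `vulMu` -/
def vulMu' (a ε q t : ℝ) : ℝ := a*ε*q/(q-t)^2

/-- Vulanović mesh generating function -/
def vulLam (a ε q t : ℝ) : ℝ :=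
  let α := vulAlpha a ε q
  if t ≤ α then vulMu a ε q t
  else if t ≤ 1/2 then vulMu a ε q α + vulMu' a ε q α * (t-α)
  else 1 - (if 1-t ≤ α then vulMu a ε q (1-t)
            else vulMu a ε q α + vulMu' a ε q α * ((1-t)-α))

/-- Vulanović mesh nodes `x_i = λ(i/n)` -/
def vulMesh (a ε q : ℝ) (n i : ℕ) : ℝ := vulLam a ε q ((i:ℝ)/(n:ℝ))

/-- the three-point discrete scheme for the linear problem
`-ε² y_{x̄x̂,i} + b(x_i) y_i = g(x_i)`, `y_0 = y_n = 0` -/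
def LinScheme (bc gc : ℝ → ℝ) (ε : ℝ) (x : ℕ → ℝ) (n : ℕ) (y : ℕ → ℝ) : Prop :=
  (∀ i : ℕ, 1 ≤ i → i < n →
    -ε ^ 2 * ddiff x y i + bc (x i) * y i = gc (x i)) ∧
  y 0 = 0 ∧ y n = 0

/-- the nonlinear discrete scheme `-ε² y_{x̄x̂,i} + f(x_i, y_i) = 0`, `y_0 = y_n = 0` -/
def NonlinScheme (f : ℝ → ℝ → ℝ) (ε : ℝ) (x : ℕ → ℝ) (n : ℕ) (y : ℕ → ℝ) : Prop :=
  (∀ i : ℕ, 1 ≤ i → i < n → -ε ^ 2 * ddiff x y i + f (x i) (y i) = 0) ∧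
  y 0 = 0 ∧ y n = 0

/-- `u` is a C²-solution of the continuous linear problem
`-ε²u'' + b(x)u = g(x)`, `u(0)=u(1)=0`. -/
def IsLinSolution (bc gc : ℝ → ℝ) (ε : ℝ) (u : ℝ → ℝ) : Prop :=
  ContDiffOn ℝ 2 u (Icc (0:ℝ) 1) ∧
  (∀ x ∈ Ioo (0:ℝ) 1,
    -ε ^ 2 * iteratedDerivWithin 2 u (Icc (0:ℝ) 1) x + bc x * u x = gc x) ∧
  u 0 = 0 ∧ u 1 = 0

/-- `b(x,ε)` is three times continuously differentiable in `x` on `[0,1]`,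
with these derivatives bounded uniformly in `ε ∈ [0,1]`. -/
def UnifC3 (b : ℝ → ℝ → ℝ) : Prop :=
  ∃ M : ℝ, ∀ ε ∈ Icc (0:ℝ) 1,
    ContDiffOn ℝ 3 (fun x => b x ε) (Icc (0:ℝ) 1) ∧
    ∀ j : ℕ, j ≤ 3 → ∀ x ∈ Icc (0:ℝ) 1,
      |iteratedDerivWithin j (fun x => b x ε) (Icc (0:ℝ) 1) x| ≤ M

/-- `w` is the continuous piecewise-linear interpolant of mesh data `y`
on the mesh `x_0 < … < x_n`. -/
def IsLinInterp (x : ℕ → ℝ) (n : ℕ) (y : ℕ → ℝ) (w : ℝ → ℝ) : Prop :=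
  (∀ i ≤ n, w (x i) = y i) ∧
  ∀ i < n, ∀ t ∈ Icc (x i) (x (i+1)),
    w t = y i + (y (i+1) - y i) * (t - x i) / (x (i+1) - x i)

/-- properties of the initial guess `u⁰`: of class C³, within `ρ` of the
solution `u`, and satisfying ε-uniform bounds of layer type for `j = 0, 1`. -/
def InitGuess (c₀ ε C₀ ρ : ℝ) (u u0 : ℝ → ℝ) : Prop :=
  ContDiffOn ℝ 3 u0 (Icc (0:ℝ) 1) ∧
  (∀ x ∈ Icc (0:ℝ) 1, |u0 x - u x| ≤ ρ) ∧
  (∀ x ∈ Icc (0:ℝ) 1, |u0 x| ≤ C₀) ∧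
  (∀ x ∈ Icc (0:ℝ) 1, |derivWithin u0 (Icc (0:ℝ) 1) x| ≤
    C₀ * (1 + ε⁻¹ * (Real.exp (-c₀*x/ε) + Real.exp (-c₀*(1-x)/ε))))

/-- the discrete Newton (quasilinearization) iterates on the mesh `x`:
`y⁰_i = u⁰(x_i)` and `y^{m+1}` solves the quasilinearized discrete problem. -/
def NewtonIter (f : ℝ → ℝ → ℝ) (ε : ℝ) (x : ℕ → ℝ) (n : ℕ) (u0 : ℝ → ℝ)
    (Y : ℕ → ℕ → ℝ) : Prop :=
  (∀ i ≤ n, Y 0 i = u0 (x i)) ∧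
  ∀ m : ℕ,
    (∀ i : ℕ, 1 ≤ i → i < n →
      -ε ^ 2 * ddiff x (Y (m+1)) i + pderiv1 f (x i) (Y m i) * Y (m+1) i
        = -f (x i) (Y m i) + pderiv1 f (x i) (Y m i) * Y m i) ∧
    Y (m+1) 0 = 0 ∧ Y (m+1) n = 0

open Set Real Topology Filter

lemma mvt_aux {φ φ' : ℝ → ℝ} {x y S : ℝ}
    (h : ∀ z ∈ uIcc x y, HasDerivWithinAt φ (φ' z) (uIcc x y) z)
    (hS : ∀ z ∈ uIcc x y, |φ' z| ≤ S) : ∀ z ∈ uIcc x y, |φ z - φ x| ≤ S * |y - x| := by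
  intro z hz
  have h1 := (convex_uIcc x y).norm_image_sub_le_of_norm_hasDerivWithin_le (C := S) h
    (by simpa using hS) left_mem_uIcc hz
  simp only [Real.norm_eq_abs] at h1
  have hS0 : 0 ≤ S := (abs_nonneg _).trans (hS x left_mem_uIcc)
  have h2 : |z - x| ≤ |y - x| := by
    have := abs_sub_left_of_mem_uIcc hz
    simpa using this
  exact h1.trans (by gcongr)

lemma uIcc_sub_unit {x y : ℝ} (hx : x ∈ Icc (0:ℝ) 1) (hy : y ∈ Icc (0:ℝ) 1) :
    uIcc x y ⊆ Icc (0:ℝ) 1 := uIcc_subset_Icc hx hy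

lemma taylor2 {f f1 f2 : ℝ → ℝ} {x y S : ℝ}
    (hx : x ∈ Icc (0:ℝ) 1) (hy : y ∈ Icc (0:ℝ) 1)
    (h1 : ∀ z ∈ Icc (0:ℝ) 1, HasDerivWithinAt f (f1 z) (Icc 0 1) z)
    (h2 : ∀ z ∈ Icc (0:ℝ) 1, HasDerivWithinAt f1 (f2 z) (Icc 0 1) z)
    (hS : ∀ z ∈ uIcc x y, |f2 z| ≤ S) :
    |f y - f x - f1 x * (y - x)| ≤ S * (y - x) ^ 2 := by
  have hs := uIcc_sub_unit hx hy
  have a1 := mvt_aux (φ := f1) (fun z hz => (h2 z (hs hz)).mono hs) hS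
  have a2 := mvt_aux (φ := fun z => f z - f1 x * (z - x)) (φ' := fun z => f1 z - f1 x)
    (x := x) (y := y) (S := S * |y - x|)
    (fun z hz => by
      have := ((h1 z (hs hz)).mono hs).sub
        ((((hasDerivAt_id z).sub_const x).const_mul (f1 x)).hasDerivWithinAt (s := uIcc x y))
      refine HasDerivWithinAt.congr_deriv this ?_
      simp)
    a1 y right_mem_uIcc
  calc |f y - f x - f1 x * (y - x)| = |f y - f1 x * (y - x) - (f x - f1 x * (x - x))| := by
        congr 1; ring
    _ ≤ S * |y - x| * |y - x| := a2
    _ = S * (y - x) ^ 2 := by rw [← sq_abs (y - x)]; ring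

lemma taylor4 {f f1 f2 f3 f4 : ℝ → ℝ} {x y S : ℝ}
    (hx : x ∈ Icc (0:ℝ) 1) (hy : y ∈ Icc (0:ℝ) 1)
    (h1 : ∀ z ∈ Icc (0:ℝ) 1, HasDerivWithinAt f (f1 z) (Icc 0 1) z)
    (h2 : ∀ z ∈ Icc (0:ℝ) 1, HasDerivWithinAt f1 (f2 z) (Icc 0 1) z)
    (h3 : ∀ z ∈ Icc (0:ℝ) 1, HasDerivWithinAt f2 (f3 z) (Icc 0 1) z)
    (h4 : ∀ z ∈ Icc (0:ℝ) 1, HasDerivWithinAt f3 (f4 z) (Icc 0 1) z)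
    (hS : ∀ z ∈ uIcc x y, |f4 z| ≤ S) :
    |f y - f x - f1 x * (y - x) - f2 x * (y - x) ^ 2 / 2 - f3 x * (y - x) ^ 3 / 6|
      ≤ S * (y - x) ^ 4 := by
  have hs := uIcc_sub_unit hx hy
  have a1 := mvt_aux (φ := f3) (fun z hz => (h4 z (hs hz)).mono hs) hS
  have a2 := mvt_aux (φ := fun z => f2 z - f3 x * (z - x)) (φ' := fun z => f3 z - f3 x)
    (x := x) (y := y) (S := S * |y - x|)
    (fun z hz => by
      have := ((h3 z (hs hz)).mono hs).sub
        ((((hasDerivAt_id z).sub_const x).const_mul (f3 x)).hasDerivWithinAt (s := uIcc x y))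
      refine HasDerivWithinAt.congr_deriv this ?_
      simp)
    a1
  have a3 := mvt_aux (φ := fun z => f1 z - f2 x * (z - x) - f3 x * ((z - x) ^ 2 / 2))
    (φ' := fun z => f2 z - f3 x * (z - x) - (f2 x - f3 x * (x - x)))
    (x := x) (y := y) (S := S * |y - x| * |y - x|)
    (fun z hz => by
      have := (((h2 z (hs hz)).mono hs).sub
        ((((hasDerivAt_id z).sub_const x).const_mul (f2 x)).hasDerivWithinAt (s := uIcc x y))).sub
        ((((((hasDerivAt_id z).sub_const x).pow 2).div_const 2).const_mul (f3 x)).hasDerivWithinAt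
          (s := uIcc x y))
      refine HasDerivWithinAt.congr_deriv this ?_
      simp; ring)
    a2
  have a4 := mvt_aux (φ := fun z => f z - f1 x * (z - x) - f2 x * ((z - x) ^ 2 / 2)
      - f3 x * ((z - x) ^ 3 / 6))
    (φ' := fun z => f1 z - f2 x * (z - x) - f3 x * ((z - x) ^ 2 / 2)
      - (f1 x - f2 x * (x - x) - f3 x * ((x - x) ^ 2 / 2)))
    (x := x) (y := y) (S := S * |y - x| * |y - x| * |y - x|)
    (fun z hz => by
      have := ((((h1 z (hs hz)).mono hs).sub
        ((((hasDerivAt_id z).sub_const x).const_mul (f1 x)).hasDerivWithinAt (s := uIcc x y))).sub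
        ((((((hasDerivAt_id z).sub_const x).pow 2).div_const 2).const_mul (f2 x)).hasDerivWithinAt
          (s := uIcc x y))).sub
        ((((((hasDerivAt_id z).sub_const x).pow 3).div_const 6).const_mul (f3 x)).hasDerivWithinAt
          (s := uIcc x y))
      refine HasDerivWithinAt.congr_deriv this ?_
      simp; ring)
    a3 y right_mem_uIcc
  have e : |y - x| ^ 4 = (y - x) ^ 4 := by rw [Even.pow_abs (by decide)]
  refine le_trans (le_of_eq ?_) (a4.trans (le_of_eq ?_))
  · congr 1; ring
  · rw [← e]; ring

/-- divided second difference -/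
def dd3 (xm x xp um u up : ℝ) : ℝ :=
  2 / (xp - xm) * ((up - u) / (xp - x) - (u - um) / (x - xm))

lemma dd3_bound1 {f f1 f2 : ℝ → ℝ} {xm x xp S : ℝ} (hxm : 0 ≤ xm) (hxp : xp ≤ 1)
    (hm : xm < x) (hp : x < xp)
    (h1 : ∀ z ∈ Icc (0:ℝ) 1, HasDerivWithinAt f (f1 z) (Icc 0 1) z)
    (h2 : ∀ z ∈ Icc (0:ℝ) 1, HasDerivWithinAt f1 (f2 z) (Icc 0 1) z)
    (hS : ∀ z ∈ Icc xm xp, |f2 z| ≤ S) :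
    |dd3 xm x xp (f xm) (f x) (f xp) - f2 x| ≤ 3 * S := by
  have t1 := taylor2 (x := x) (y := xp) ⟨by linarith, by linarith⟩ ⟨by linarith, by linarith⟩ h1 h2
    (S := S) (fun z hz => by
      rw [uIcc_of_le hp.le] at hz; exact hS z ⟨by linarith [hz.1], hz.2⟩)
  have t2 := taylor2 (x := x) (y := xm) ⟨by linarith, by linarith⟩ ⟨by linarith, by linarith⟩ h1 h2
    (S := S) (fun z hz => by
      rw [uIcc_of_ge hm.le] at hz; exact hS z ⟨hz.1, by linarith [hz.2]⟩)
  have t3 := hS x ⟨hm.le, hp.le⟩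
  set Rp := f xp - f x - f1 x * (xp - x) with hRp
  set Rm := f xm - f x - f1 x * (xm - x) with hRm
  have e : dd3 xm x xp (f xm) (f x) (f xp)
      = 2 / (xp - xm) * (Rp / (xp - x) + Rm / (x - xm)) := by
    have n1 : xp - x ≠ 0 := by linarith
    have n2 : x - xm ≠ 0 := by linarith
    have n3 : xp - xm ≠ 0 := by linarith
    rw [dd3, hRp, hRm]; field_simp; ring
  have b1 : |Rp / (xp - x)| ≤ S * (xp - x) := by
    rw [abs_div, abs_of_pos (sub_pos.2 hp), div_le_iff₀ (sub_pos.2 hp)]; linarith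
  have b2 : |Rm / (x - xm)| ≤ S * (x - xm) := by
    rw [abs_div, abs_of_pos (sub_pos.2 hm), div_le_iff₀ (sub_pos.2 hm)]; linarith
  have b3 : |dd3 xm x xp (f xm) (f x) (f xp)| ≤ 2 * S := by
    have p : 0 < xp - xm := by linarith
    rw [e, abs_mul, abs_of_pos (by positivity), div_mul_eq_mul_div, div_le_iff₀ p]
    have := abs_add_le (Rp / (xp - x)) (Rm / (x - xm))
    linarith
  have := abs_sub (dd3 xm x xp (f xm) (f x) (f xp)) (f2 x)
  linarith

lemma dd3_bound2 {f f1 f2 f3 f4 : ℝ → ℝ} {xm x xp S : ℝ} (hxm : 0 ≤ xm) (hxp : xp ≤ 1)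
    (hm : xm < x) (hp : x < xp)
    (h1 : ∀ z ∈ Icc (0:ℝ) 1, HasDerivWithinAt f (f1 z) (Icc 0 1) z)
    (h2 : ∀ z ∈ Icc (0:ℝ) 1, HasDerivWithinAt f1 (f2 z) (Icc 0 1) z)
    (h3 : ∀ z ∈ Icc (0:ℝ) 1, HasDerivWithinAt f2 (f3 z) (Icc 0 1) z)
    (h4 : ∀ z ∈ Icc (0:ℝ) 1, HasDerivWithinAt f3 (f4 z) (Icc 0 1) z)
    (hS : ∀ z ∈ Icc xm xp, |f4 z| ≤ S) :
    |dd3 xm x xp (f xm) (f x) (f xp) - f2 x| ≤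
      |(xp - x) - (x - xm)| * |f3 x| + 2 * S * ((xp - x) ^ 2 + (x - xm) ^ 2) := by
  have t1 := taylor4 (x := x) (y := xp) ⟨by linarith, by linarith⟩ ⟨by linarith, by linarith⟩
    h1 h2 h3 h4
    (S := S) (fun z hz => by
      rw [uIcc_of_le hp.le] at hz; exact hS z ⟨by linarith [hz.1], hz.2⟩)
  have t2 := taylor4 (x := x) (y := xm) ⟨by linarith, by linarith⟩ ⟨by linarith, by linarith⟩
    h1 h2 h3 h4
    (S := S) (fun z hz => by
      rw [uIcc_of_ge hm.le] at hz; exact hS z ⟨hz.1, by linarith [hz.2]⟩)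
  have t3 : 0 ≤ S := (abs_nonneg _).trans (hS x ⟨hm.le, hp.le⟩)
  set Rp := f xp - f x - f1 x * (xp - x) - f2 x * (xp - x) ^ 2 / 2 - f3 x * (xp - x) ^ 3 / 6
    with hRp
  set Rm := f xm - f x - f1 x * (xm - x) - f2 x * (xm - x) ^ 2 / 2 - f3 x * (xm - x) ^ 3 / 6
    with hRm
  have e : dd3 xm x xp (f xm) (f x) (f xp) - f2 x
      = ((xp - x) - (x - xm)) * f3 x / 3 + 2 / (xp - xm) * (Rp / (xp - x) + Rm / (x - xm)) := by
    have n1 : xp - x ≠ 0 := by linarith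
    have n2 : x - xm ≠ 0 := by linarith
    have n3 : xp - xm ≠ 0 := by linarith
    rw [dd3, hRp, hRm]; field_simp; ring
  have b1 : |Rp / (xp - x)| ≤ S * (xp - x) ^ 3 := by
    rw [abs_div, abs_of_pos (sub_pos.2 hp), div_le_iff₀ (sub_pos.2 hp)]; linarith
  have b2 : |Rm / (x - xm)| ≤ S * (x - xm) ^ 3 := by
    rw [abs_div, abs_of_pos (sub_pos.2 hm), div_le_iff₀ (sub_pos.2 hm)]; linarith
  have b3 : |2 / (xp - xm) * (Rp / (xp - x) + Rm / (x - xm))|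
      ≤ 2 * S * ((xp - x) ^ 2 + (x - xm) ^ 2) := by
    have p : 0 < xp - xm := by linarith
    rw [abs_mul, abs_of_pos (by positivity), div_mul_eq_mul_div, div_le_iff₀ p]
    have h5 := abs_add_le (Rp / (xp - x)) (Rm / (x - xm))
    have hP : 0 < xp - x := by linarith
    have hM : 0 < x - xm := by linarith
    have e2 : 2 * S * ((xp - x) ^ 2 + (x - xm) ^ 2) * (xp - xm)
      = 2 * (S * (xp - x) ^ 3 + S * (x - xm) ^ 3) + 2 * S * ((xp - x) ^ 2 * (x - xm)
          + (x - xm) ^ 2 * (xp - x)) := by ring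
    rw [e2]
    have : 0 ≤ 2 * S * ((xp - x) ^ 2 * (x - xm) + (x - xm) ^ 2 * (xp - x)) := by positivity
    linarith
  have b4 : |((xp - x) - (x - xm)) * f3 x / 3| ≤ |(xp - x) - (x - xm)| * |f3 x| := by
    rw [abs_div, abs_mul, abs_of_pos (by norm_num : (0:ℝ) < 3)]
    have : 0 ≤ |(xp - x) - (x - xm)| * |f3 x| := by positivity
    linarith
  rw [e]
  exact (abs_add_le _ _).trans (add_le_add b4 b3)

lemma interp_deriv {f f1 f2 : ℝ → ℝ} {x δ A B : ℝ} (hx : x ∈ Icc (0:ℝ) 1)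
    (hδ : 0 < δ) (hδ2 : δ ≤ 1 / 2)
    (h1 : ∀ z ∈ Icc (0:ℝ) 1, HasDerivWithinAt f (f1 z) (Icc 0 1) z)
    (h2 : ∀ z ∈ Icc (0:ℝ) 1, HasDerivWithinAt f1 (f2 z) (Icc 0 1) z)
    (hA : ∀ z ∈ Icc (0:ℝ) 1, |z - x| ≤ δ → |f z| ≤ A)
    (hB : ∀ z ∈ Icc (0:ℝ) 1, |z - x| ≤ δ → |f2 z| ≤ B) :
    |f1 x| ≤ 2 * A / δ + B * δ := by
  obtain ⟨y, hy, hyx⟩ : ∃ y ∈ Icc (0:ℝ) 1, |y - x| = δ := by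
    rcases le_total x (1/2) with h | h
    · exact ⟨x + δ, ⟨by linarith [hx.1], by linarith⟩, by simp [abs_of_pos hδ]⟩
    · exact ⟨x - δ, ⟨by linarith [hx.1], by linarith [hx.2]⟩, by simp [abs_of_pos hδ]⟩
  have hs := uIcc_sub_unit hx hy
  have t := taylor2 hx hy h1 h2 (S := B) (fun z hz => hB z (hs hz) (by
    have := abs_sub_left_of_mem_uIcc hz
    rw [← hyx]; exact this))
  have a1 := hA y hy hyx.le
  have a2 := hA x hx (by simpa using hδ.le)
  have e : |f1 x| * δ ≤ 2 * A + B * δ ^ 2 := by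
    rw [← hyx, ← abs_mul, sq_abs]
    have : f1 x * (y - x) = f y - f x - (f y - f x - f1 x * (y - x)) := by ring
    rw [this]
    have i1 := abs_sub (f y - f x) (f y - f x - f1 x * (y - x))
    have i2 := abs_sub (f y) (f x)
    linarith
  have : 2 * A / δ + B * δ = (2 * A + B * δ ^ 2) / δ := by field_simp
  rw [this, le_div_iff₀ hδ]; exact e

lemma maxprin {z z1 z2 : ℝ → ℝ}
    (h1 : ∀ x ∈ Icc (0:ℝ) 1, HasDerivWithinAt z (z1 x) (Icc 0 1) x)
    (h2 : ∀ x ∈ Icc (0:ℝ) 1, HasDerivWithinAt z1 (z2 x) (Icc 0 1) x)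
    (hz : ∀ x ∈ Ioo (0:ℝ) 1, 0 < z x → 0 < z2 x) (h0 : z 0 ≤ 0) (h01 : z 1 ≤ 0) :
    ∀ x ∈ Icc (0:ℝ) 1, z x ≤ 0 := by
  have hc : ContinuousOn z (Icc 0 1) := fun x hx => (h1 x hx).continuousWithinAt
  obtain ⟨m, hm, hmax⟩ := isCompact_Icc.exists_isMaxOn (⟨0, by simp⟩ : (Icc (0:ℝ) 1).Nonempty) hc
  intro x hx
  refine (hmax hx).trans ?_
  by_contra hcon
  push Not at hcon
  have hm' : m ∈ Ioo (0:ℝ) 1 := by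
    refine ⟨lt_of_le_of_ne hm.1 ?_, lt_of_le_of_ne hm.2 ?_⟩
    · rintro rfl; linarith
    · rintro rfl; linarith
  have hnh : Icc (0:ℝ) 1 ∈ 𝓝 m := Icc_mem_nhds hm'.1 hm'.2
  have hd1 : ∀ y ∈ Ioo (0:ℝ) 1, HasDerivAt z (z1 y) y := fun y hy =>
    (h1 y (Ioo_subset_Icc_self hy)).hasDerivAt (Icc_mem_nhds hy.1 hy.2)
  have hev : deriv z =ᶠ[𝓝 m] z1 := by
    filter_upwards [Ioo_mem_nhds hm'.1 hm'.2] with y hy using (hd1 y hy).deriv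
  have hd2 : deriv (deriv z) m = z2 m := by
    rw [hev.deriv_eq]; exact ((h2 m hm).hasDerivAt hnh).deriv
  have hlm : IsLocalMax z m := hmax.isLocalMax hnh
  have hpos := hz m hm' hcon
  have hmin := isLocalMin_of_deriv_deriv_pos (f := z) (x₀ := m) (by rw [hd2]; exact hpos)
    hlm.deriv_eq_zero (hd1 m hm').continuousAt
  have heq : z =ᶠ[𝓝 m] fun _ => z m := by
    filter_upwards [hmin, hlm] with y a b using le_antisymm b a
  have : deriv (deriv z) m = 0 := by
    have h3 : deriv z =ᶠ[𝓝 m] fun _ => 0 := by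
      filter_upwards [heq.eventuallyEq_nhds] with y hy
      rw [hy.deriv_eq]; simp
    rw [h3.deriv_eq]; simp
  linarith

/-- boundary layer function -/
def layE (γ ε x : ℝ) : ℝ := Real.exp (-(γ * x / ε)) + Real.exp (-(γ * (1 - x) / ε))

lemma layE_pos (γ ε x : ℝ) : 0 < layE γ ε x := by unfold layE; positivity

lemma layE_le_two {γ ε x : ℝ} (hγ : 0 ≤ γ) (hε : 0 < ε) (hx : x ∈ Icc (0:ℝ) 1) :
    layE γ ε x ≤ 2 := by
  have h1 : 0 ≤ γ * x / ε := div_nonneg (mul_nonneg hγ hx.1) hε.le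
  have h2 : 0 ≤ γ * (1 - x) / ε := div_nonneg (mul_nonneg hγ (by linarith [hx.2])) hε.le
  have h3 := Real.exp_le_one_iff.2 (neg_nonpos.2 h1)
  have h4 := Real.exp_le_one_iff.2 (neg_nonpos.2 h2)
  unfold layE; linarith

lemma layE_zero (γ ε : ℝ) : 1 ≤ layE γ ε 0 := by
  unfold layE; simp [Real.exp_nonneg]

lemma layE_one (γ ε : ℝ) : 1 ≤ layE γ ε 1 := by
  unfold layE; simp [Real.exp_nonneg]

lemma layE_near {γ ε x z : ℝ} (hγ : 0 ≤ γ) (hε : 0 < ε) (h : |z - x| ≤ ε / 2) :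
    layE γ ε z ≤ Real.exp γ * layE γ ε x := by
  have h' := abs_le.1 h
  unfold layE
  rw [mul_add, ← Real.exp_add, ← Real.exp_add]
  have e1 : γ + -(γ * x / ε) - -(γ * z / ε) = γ * ((ε - (x - z)) / ε) := by field_simp; ring
  have e2 : γ + -(γ * (1 - x) / ε) - -(γ * (1 - z) / ε) = γ * ((ε - (z - x)) / ε) := by
    field_simp; ring
  have p1 : 0 ≤ γ * ((ε - (x - z)) / ε) :=
    mul_nonneg hγ (div_nonneg (by linarith) hε.le)
  have p2 : 0 ≤ γ * ((ε - (z - x)) / ε) :=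
    mul_nonneg hγ (div_nonneg (by linarith) hε.le)
  exact add_le_add (Real.exp_le_exp.2 (by linarith)) (Real.exp_le_exp.2 (by linarith))

/-- first derivative of the layer function -/
def layE1 (γ ε x : ℝ) : ℝ :=
  γ / ε * (-Real.exp (-(γ * x / ε)) + Real.exp (-(γ * (1 - x) / ε)))

lemma layE_deriv (γ ε x : ℝ) : HasDerivAt (layE γ ε) (layE1 γ ε x) x := by
  have a1 : HasDerivAt (fun x : ℝ => -(γ * x / ε)) (-(γ * 1 / ε)) x :=
    (((hasDerivAt_id x).const_mul γ).div_const ε).neg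
  have a2 : HasDerivAt (fun x : ℝ => -(γ * (1 - x) / ε)) (-(γ * (-1) / ε)) x :=
    ((((hasDerivAt_id x).const_sub 1).const_mul γ).div_const ε).neg
  refine HasDerivAt.congr_deriv (a1.exp.add a2.exp) ?_
  unfold layE1; ring

lemma layE1_deriv (γ ε x : ℝ) : HasDerivAt (layE1 γ ε) ((γ / ε) ^ 2 * layE γ ε x) x := by
  have a1 : HasDerivAt (fun x : ℝ => -(γ * x / ε)) (-(γ * 1 / ε)) x :=
    (((hasDerivAt_id x).const_mul γ).div_const ε).neg
  have a2 : HasDerivAt (fun x : ℝ => -(γ * (1 - x) / ε)) (-(γ * (-1) / ε)) x :=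
    ((((hasDerivAt_id x).const_sub 1).const_mul γ).div_const ε).neg
  refine HasDerivAt.congr_deriv ((a1.exp.neg.add a2.exp).const_mul (γ / ε)) ?_
  unfold layE; ring

lemma barrier {β γ ε R0 R2 : ℝ} (hβ : 0 < β) (hγ : γ ^ 2 = β) (hε : 0 < ε)
    (hR0 : 0 ≤ R0) (hR2 : 0 ≤ R2) {b w w1 w2 p : ℝ → ℝ}
    (hw1 : ∀ x ∈ Icc (0:ℝ) 1, HasDerivWithinAt w (w1 x) (Icc 0 1) x)
    (hw2 : ∀ x ∈ Icc (0:ℝ) 1, HasDerivWithinAt w1 (w2 x) (Icc 0 1) x)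
    (hb : ∀ x ∈ Icc (0:ℝ) 1, β ≤ b x)
    (hp : ∀ x ∈ Icc (0:ℝ) 1, |p x| ≤ R2)
    (heq : ∀ x ∈ Icc (0:ℝ) 1, ε ^ 2 * w2 x = b x * w x - ε ^ 2 * p x)
    (h0 : w 0 ≤ R0) (h1 : w 1 ≤ R0) :
    ∀ x ∈ Icc (0:ℝ) 1, w x ≤ R2 / β * ε ^ 2 + R0 * layE γ ε x := by
  have key := maxprin (z := fun x => w x - (R2 / β * ε ^ 2 + R0 * layE γ ε x))
    (z1 := fun x => w1 x - R0 * layE1 γ ε x)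
    (z2 := fun x => w2 x - R0 * ((γ / ε) ^ 2 * layE γ ε x))
    (fun x hx => by
      refine ((hw1 x hx).sub (((layE_deriv γ ε x).const_mul R0).const_add
        (R2 / β * ε ^ 2)).hasDerivWithinAt))
    (fun x hx => (hw2 x hx).sub ((layE1_deriv γ ε x).const_mul R0).hasDerivWithinAt)
    (fun x hx hz => by
      have hx' := Ioo_subset_Icc_self hx
      have e1 := heq x hx'
      have e2 := hb x hx'
      have e3 := (abs_le.1 (hp x hx')).2
      have hE := layE_pos γ ε x
      have hwpos : 0 < w x := by
        have : 0 ≤ R2 / β * ε ^ 2 + R0 * layE γ ε x := by positivity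
        linarith
      have e4 : β * (R2 / β * ε ^ 2 + R0 * layE γ ε x) < b x * w x := by
        calc β * (R2 / β * ε ^ 2 + R0 * layE γ ε x) < β * w x := by
              apply mul_lt_mul_of_pos_left _ hβ; linarith
          _ ≤ b x * w x := by gcongr
      have e5 : β * (R2 / β * ε ^ 2 + R0 * layE γ ε x) = R2 * ε ^ 2 + R0 * (β * layE γ ε x) := by
        field_simp
      have e6 : ε ^ 2 * (w2 x - R0 * ((γ / ε) ^ 2 * layE γ ε x))
          = b x * w x - ε ^ 2 * p x - R0 * (β * layE γ ε x) := by
        rw [mul_sub, e1, ← hγ]; field_simp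
      have e7 : ε ^ 2 * p x ≤ ε ^ 2 * R2 := by gcongr
      have e8 : 0 < ε ^ 2 * (w2 x - R0 * ((γ / ε) ^ 2 * layE γ ε x)) := by rw [e6]; linarith
      exact pos_of_mul_pos_right e8 (by positivity))
    (by
      have := layE_zero γ ε
      have t : 0 ≤ R2 / β * ε ^ 2 := by positivity
      nlinarith)
    (by
      have := layE_one γ ε
      have t : 0 ≤ R2 / β * ε ^ 2 := by positivity
      nlinarith)
  intro x hx
  have := key x hx
  linarith

set_option maxHeartbeats 1600000 in
lemma deriv_bounds {β γ M : ℝ} (hβ : 0 < β) (hγ0 : 0 ≤ γ) (hγ : γ ^ 2 = β) (hM : 0 ≤ M) :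
    ∃ K : ℝ, 0 < K ∧ ∀ ε : ℝ, 0 < ε → ε ≤ 1 → ∀ b b1 b2 g g1 g2 u u1 u2 : ℝ → ℝ,
    (∀ x ∈ Icc (0:ℝ) 1, HasDerivWithinAt b (b1 x) (Icc 0 1) x) →
    (∀ x ∈ Icc (0:ℝ) 1, HasDerivWithinAt b1 (b2 x) (Icc 0 1) x) →
    (∀ x ∈ Icc (0:ℝ) 1, HasDerivWithinAt g (g1 x) (Icc 0 1) x) →
    (∀ x ∈ Icc (0:ℝ) 1, HasDerivWithinAt g1 (g2 x) (Icc 0 1) x) →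
    (∀ x ∈ Icc (0:ℝ) 1, HasDerivWithinAt u (u1 x) (Icc 0 1) x) →
    (∀ x ∈ Icc (0:ℝ) 1, HasDerivWithinAt u1 (u2 x) (Icc 0 1) x) →
    (∀ x ∈ Icc (0:ℝ) 1, |b x| ≤ M ∧ |b1 x| ≤ M ∧ |b2 x| ≤ M) →
    (∀ x ∈ Icc (0:ℝ) 1, |g x| ≤ M ∧ |g1 x| ≤ M ∧ |g2 x| ≤ M) →
    (∀ x ∈ Icc (0:ℝ) 1, β ≤ b x) →
    (∀ x ∈ Icc (0:ℝ) 1, ε ^ 2 * u2 x = b x * u x - g x) →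
    u 0 = 0 → u 1 = 0 →
    ∃ u3 u4 : ℝ → ℝ,
      (∀ x ∈ Icc (0:ℝ) 1, HasDerivWithinAt u2 (u3 x) (Icc 0 1) x) ∧
      (∀ x ∈ Icc (0:ℝ) 1, HasDerivWithinAt u3 (u4 x) (Icc 0 1) x) ∧
      (∀ x ∈ Icc (0:ℝ) 1, ε ^ 2 * |u2 x| ≤ K * (ε ^ 2 + layE γ ε x)) ∧
      (∀ x ∈ Icc (0:ℝ) 1, ε ^ 2 * |u3 x| ≤ K * (ε + layE γ ε x / ε)) ∧
      (∀ x ∈ Icc (0:ℝ) 1, ε ^ 2 * |u4 x| ≤ K * (1 + layE γ ε x / ε ^ 2)) := by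
  obtain ⟨R0, hR0⟩ : ∃ R0, R0 = M / β := ⟨_, rfl⟩
  have pR0 : 0 ≤ R0 := by rw [hR0]; positivity
  obtain ⟨R1, hR1⟩ : ∃ R1, R1 = (M + M * R0) / β := ⟨_, rfl⟩
  have pR1 : 0 ≤ R1 := by rw [hR1]; positivity
  obtain ⟨R2, hR2⟩ : ∃ R2, R2 = (M + M * R0 + 2 * (M * R1)) / β := ⟨_, rfl⟩
  have pR2 : 0 ≤ R2 := by rw [hR2]; positivity
  obtain ⟨A, hA⟩ : ∃ A, A = R2 / β + R0 := ⟨_, rfl⟩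
  have pA : 0 ≤ A := by rw [hA]; positivity
  obtain ⟨B, hB⟩ : ∃ B, B = M * A + R2 := ⟨_, rfl⟩
  have pB : 0 ≤ B := by rw [hB]; positivity
  obtain ⟨D, hD⟩ : ∃ D, D = (4 * A + B) * Real.exp γ := ⟨_, rfl⟩
  have pD : 0 ≤ D := by rw [hD]; positivity
  refine ⟨M * A + 2 * (M * D) + M * B + 1, by positivity, ?_⟩
  intro ε hε hε1 b b1 b2 g g1 g2 u u1 u2 hb hb1 hg hg1 hu hu1 bM gM hbβ heq u00 u01
  have hbpos : ∀ x ∈ Icc (0:ℝ) 1, 0 < b x := fun x hx => hβ.trans_le (hbβ x hx)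
  set r : ℝ → ℝ := fun x => g x / b x with hr
  set r1 : ℝ → ℝ := fun x => (g1 x - b1 x * r x) / b x with hr1
  set r2 : ℝ → ℝ := fun x => (g2 x - b2 x * r x - 2 * (b1 x * r1 x)) / b x with hr2
  have dr : ∀ x ∈ Icc (0:ℝ) 1, HasDerivWithinAt r (r1 x) (Icc 0 1) x := by
    intro x hx
    have := (hbpos x hx).ne'
    refine ((hg x hx).div (hb x hx) this).congr_deriv ?_
    simp only [hr1, hr]; field_simp
  have dr1 : ∀ x ∈ Icc (0:ℝ) 1, HasDerivWithinAt r1 (r2 x) (Icc 0 1) x := by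
    intro x hx
    have := (hbpos x hx).ne'
    refine (((hg1 x hx).sub ((hb1 x hx).mul (dr x hx))).div (hb x hx) this).congr_deriv ?_
    simp only [hr2, hr1, Pi.sub_apply, Pi.mul_apply]; field_simp; ring
  have br : ∀ x ∈ Icc (0:ℝ) 1, |r x| ≤ R0 := by
    intro x hx
    simp only [hr]
    rw [abs_div, abs_of_pos (hbpos x hx), hR0]
    exact div_le_div₀ hM (gM x hx).1 hβ (hbβ x hx)
  have br1 : ∀ x ∈ Icc (0:ℝ) 1, |r1 x| ≤ R1 := by
    intro x hx
    simp only [hr1]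
    rw [abs_div, abs_of_pos (hbpos x hx), hR1]
    refine div_le_div₀ (by positivity) ?_ hβ (hbβ x hx)
    refine (abs_sub _ _).trans ?_
    rw [abs_mul]
    exact add_le_add (gM x hx).2.1 (mul_le_mul (bM x hx).2.1 (br x hx) (abs_nonneg _) hM)
  have br2 : ∀ x ∈ Icc (0:ℝ) 1, |r2 x| ≤ R2 := by
    intro x hx
    simp only [hr2]
    rw [abs_div, abs_of_pos (hbpos x hx), hR2]
    refine div_le_div₀ (by positivity) ?_ hβ (hbβ x hx)
    refine (abs_sub _ _).trans (add_le_add ((abs_sub _ _).trans (add_le_add (gM x hx).2.2 ?_)) ?_)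
    · rw [abs_mul]
      exact (mul_le_mul (bM x hx).2.2 (br x hx) (abs_nonneg _) hM)
    · rw [abs_mul, abs_mul, abs_two]
      exact mul_le_mul_of_nonneg_left
        (mul_le_mul (bM x hx).2.1 (br1 x hx) (abs_nonneg _) hM) (by norm_num)
  set w : ℝ → ℝ := fun x => u x - r x with hw
  set w1 : ℝ → ℝ := fun x => u1 x - r1 x with hw1
  set w2 : ℝ → ℝ := fun x => u2 x - r2 x with hw2
  have dw : ∀ x ∈ Icc (0:ℝ) 1, HasDerivWithinAt w (w1 x) (Icc 0 1) x :=
    fun x hx => (hu x hx).sub (dr x hx)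
  have dw1 : ∀ x ∈ Icc (0:ℝ) 1, HasDerivWithinAt w1 (w2 x) (Icc 0 1) x :=
    fun x hx => (hu1 x hx).sub (dr1 x hx)
  have hu2 : ∀ x ∈ Icc (0:ℝ) 1, ε ^ 2 * u2 x = b x * w x := by
    intro x hx
    have := (hbpos x hx).ne'
    rw [heq x hx]; simp only [hw, hr]; field_simp
  have hweq : ∀ x ∈ Icc (0:ℝ) 1, ε ^ 2 * w2 x = b x * w x - ε ^ 2 * r2 x := by
    intro x hx; simp only [hw2]; rw [mul_sub, hu2 x hx]
  have mem0 : (0:ℝ) ∈ Icc (0:ℝ) 1 := by simp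
  have mem1 : (1:ℝ) ∈ Icc (0:ℝ) 1 := by simp
  have bw : ∀ x ∈ Icc (0:ℝ) 1, |w x| ≤ A * (ε ^ 2 + layE γ ε x) := by
    intro x hx
    have i1 := barrier hβ hγ hε pR0 pR2 dw dw1 hbβ br2 hweq
      (by simp only [hw, u00]; linarith [(abs_le.1 (br 0 mem0)).1])
      (by simp only [hw, u01]; linarith [(abs_le.1 (br 1 mem1)).1]) x hx
    have i2 := barrier (w := fun x => - w x) (w1 := fun x => - w1 x) (w2 := fun x => - w2 x)
      (p := fun x => - r2 x) hβ hγ hε pR0 pR2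
      (fun x hx => (dw x hx).neg) (fun x hx => (dw1 x hx).neg) hbβ
      (fun x hx => by simpa using br2 x hx)
      (fun x hx => by linarith [hweq x hx])
      (by simp only [hw, u00]; linarith [(abs_le.1 (br 0 mem0)).2])
      (by simp only [hw, u01]; linarith [(abs_le.1 (br 1 mem1)).2]) x hx
    have hE := layE_pos γ ε x
    have i3 : R2 / β * ε ^ 2 + R0 * layE γ ε x ≤ A * (ε ^ 2 + layE γ ε x) := by
      have t1 : 0 ≤ R2 / β * layE γ ε x := by positivity
      have t2 : 0 ≤ R0 * ε ^ 2 := by positivity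
      rw [hA]; linarith
    exact abs_le.2 ⟨by linarith, by linarith⟩
  have bw2 : ∀ x ∈ Icc (0:ℝ) 1, |w2 x| ≤ B * (1 + layE γ ε x / ε ^ 2) := by
    intro x hx
    have hE := layE_pos γ ε x
    have e : w2 x = (b x * w x) / ε ^ 2 - r2 x := by
      have := hweq x hx
      field_simp; linarith
    rw [e]
    refine (abs_sub _ _).trans ?_
    rw [abs_div, abs_mul, abs_of_pos (by positivity : 0 < ε ^ 2)]
    have s1 : |b x| * |w x| ≤ M * (A * (ε ^ 2 + layE γ ε x)) :=
      mul_le_mul (bM x hx).1 (bw x hx) (abs_nonneg _) hM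
    have s2 : |b x| * |w x| / ε ^ 2 ≤ M * (A * (ε ^ 2 + layE γ ε x)) / ε ^ 2 := by gcongr
    have s3 : M * (A * (ε ^ 2 + layE γ ε x)) / ε ^ 2 = M * A * (1 + layE γ ε x / ε ^ 2) := by
      field_simp
    have s4 : 0 ≤ R2 * (layE γ ε x / ε ^ 2) := by positivity
    have := br2 x hx
    rw [hB]; linarith
  have bw1 : ∀ x ∈ Icc (0:ℝ) 1, |w1 x| ≤ D * (ε + layE γ ε x / ε) := by
    intro x hx
    have hE := layE_pos γ ε x
    have hG : 1 ≤ Real.exp γ := Real.one_le_exp hγ0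
    have i := interp_deriv (δ := ε / 2) hx (by positivity) (by linarith) dw dw1
      (A := A * (Real.exp γ * (ε ^ 2 + layE γ ε x)))
      (B := B * (Real.exp γ * (1 + layE γ ε x / ε ^ 2)))
      (fun z hz hzx => (bw z hz).trans (by
        have := layE_near (x := x) hγ0 hε hzx
        gcongr
        have t : 0 ≤ (Real.exp γ - 1) * ε ^ 2 := mul_nonneg (by linarith) (by positivity)
        linarith))
      (fun z hz hzx => (bw2 z hz).trans (by
        have := layE_near (x := x) hγ0 hε hzx
        gcongr
        have t : layE γ ε z / ε ^ 2 ≤ Real.exp γ * layE γ ε x / ε ^ 2 := by gcongr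
        rw [mul_div_assoc] at t
        linarith))
    refine i.trans ?_
    have e : 2 * (A * (Real.exp γ * (ε ^ 2 + layE γ ε x))) / (ε / 2)
        + B * (Real.exp γ * (1 + layE γ ε x / ε ^ 2)) * (ε / 2)
        = (4 * A + B / 2) * Real.exp γ * (ε + layE γ ε x / ε) := by
      field_simp; ring
    rw [e, hD]
    gcongr
    linarith
  have bE : ∀ x, ε ^ 2 + layE γ ε x ≤ ε + layE γ ε x / ε := by
    intro x
    have hE := layE_pos γ ε x
    have : layE γ ε x ≤ layE γ ε x / ε := by
      rw [le_div_iff₀ hε]; nlinarith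
    nlinarith
  have bE2 : ∀ x, ε + layE γ ε x / ε ≤ 1 + layE γ ε x / ε ^ 2 := by
    intro x
    have hE := layE_pos γ ε x
    have : layE γ ε x / ε ≤ layE γ ε x / ε ^ 2 := by
      gcongr; nlinarith
    linarith
  refine ⟨fun x => (b1 x * w x + b x * w1 x) / ε ^ 2,
    fun x => (b2 x * w x + 2 * (b1 x * w1 x) + b x * w2 x) / ε ^ 2, ?_, ?_, ?_, ?_, ?_⟩
  · intro x hx
    have h := ((hb x hx).mul (dw x hx)).div_const (ε ^ 2)
    refine h.congr_of_mem (fun y hy => ?_) hx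
    simp only [Pi.mul_apply]
    rw [← hu2 y hy]; field_simp
  · intro x hx
    have h := (((hb1 x hx).mul (dw x hx)).add ((hb x hx).mul (dw1 x hx))).div_const (ε ^ 2)
    refine h.congr_deriv ?_
    ring
  all_goals intro x hx
  all_goals
    have hE := layE_pos γ ε x
    have hb_0 := (bM x hx).1
    have hb_1 := (bM x hx).2.1
    have hb_2 := (bM x hx).2.2
    have W0 := bw x hx
    have W1 := bw1 x hx
    have W2 := bw2 x hx
    have E1 := bE x
    have E2 := bE2 x
    have P0 : 0 < ε ^ 2 + layE γ ε x := by positivity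
    have P1 : 0 < ε + layE γ ε x / ε := by positivity
    have P2 : 0 < 1 + layE γ ε x / ε ^ 2 := by positivity
    have pε : 0 < ε ^ 2 := by positivity
  · rw [← abs_of_pos pε, ← abs_mul, hu2 x hx, abs_mul, abs_of_pos pε]
    calc |b x| * |w x| ≤ M * (A * (ε ^ 2 + layE γ ε x)) := by gcongr
      _ = M * A * (ε ^ 2 + layE γ ε x) := by ring
      _ ≤ _ := by
        refine mul_le_mul_of_nonneg_right ?_ P0.le
        have : 0 ≤ 2 * (M * D) + M * B + 1 := by positivity
        nlinarith [mul_nonneg hM pD, mul_nonneg hM pB]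
  · rw [abs_div, abs_of_pos pε, mul_div_cancel₀ _ pε.ne']
    calc |b1 x * w x + b x * w1 x| ≤ |b1 x| * |w x| + |b x| * |w1 x| := by
          rw [← abs_mul, ← abs_mul]; exact abs_add_le _ _
      _ ≤ M * (A * (ε + layE γ ε x / ε)) + M * (D * (ε + layE γ ε x / ε)) := by
          gcongr
          exact W0.trans (by gcongr)
      _ = (M * A + M * D) * (ε + layE γ ε x / ε) := by ring
      _ ≤ _ := by
        refine mul_le_mul_of_nonneg_right ?_ P1.le
        have : 0 ≤ (M * D) + M * B + 1 := by positivity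
        nlinarith [mul_nonneg hM pD, mul_nonneg hM pB]
  · rw [abs_div, abs_of_pos pε, mul_div_cancel₀ _ pε.ne']
    calc |b2 x * w x + 2 * (b1 x * w1 x) + b x * w2 x|
        ≤ |b2 x| * |w x| + 2 * (|b1 x| * |w1 x|) + |b x| * |w2 x| := by
          refine (abs_add_le _ _).trans (add_le_add ((abs_add_le _ _).trans ?_) (abs_mul _ _).le)
          rw [abs_mul, abs_mul, abs_mul, abs_two]
      _ ≤ M * (A * (1 + layE γ ε x / ε ^ 2)) + 2 * (M * (D * (1 + layE γ ε x / ε ^ 2)))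
          + M * (B * (1 + layE γ ε x / ε ^ 2)) := by
          gcongr
          · exact W0.trans (mul_le_mul_of_nonneg_left (by linarith) pA)
          · exact W1.trans (by gcongr)
      _ = (M * A + 2 * (M * D) + M * B) * (1 + layE γ ε x / ε ^ 2) := by ring
      _ ≤ _ := by
        refine mul_le_mul_of_nonneg_right ?_ P2.le
        nlinarith [mul_nonneg hM pD, mul_nonneg hM pB]

lemma vul_alpha_facts {a ε q : ℝ} (hq0 : 0 < q) (hq : q < 1 / 2) (ha : 0 < a) (hε : 0 < ε)
    (haε : a * ε < q) :
    0 ≤ vulAlpha a ε q ∧ 0 < q - vulAlpha a ε q ∧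
    (q - vulAlpha a ε q) ^ 2 * (1 + 2 * (a * ε))
      = 4 * (a * ε) * q * (q - vulAlpha a ε q) + a * ε * q * (1 - 2 * q) ∧
    ε * (a * q * (1 - 2 * q)) ≤ 4 * (q - vulAlpha a ε q) ^ 2 := by
  have hp : 0 < a * ε := by positivity
  have hq2 : 0 < 1 - 2 * q := by linarith
  set s := Real.sqrt (ε * a * q * (1 - 2 * q + 2 * ε * a)) with hs
  have harg : 0 < ε * a * q * (1 - 2 * q + 2 * ε * a) := by positivity
  have hs2 : s ^ 2 = ε * a * q * (1 - 2 * q + 2 * ε * a) := Real.sq_sqrt harg.le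
  have hs0 : 0 < s := Real.sqrt_pos.2 harg
  have hα : vulAlpha a ε q = (q - s) / (1 + 2 * ε * a) := rfl
  have hd : 0 < 1 + 2 * ε * a := by positivity
  have hκ : q - vulAlpha a ε q = (2 * (a * ε) * q + s) / (1 + 2 * ε * a) := by
    rw [hα]; field_simp; ring
  have hsq : s ≤ q := by
    apply Real.sqrt_le_iff.2 ⟨hq0.le, ?_⟩
    have h1 : ε * a * (1 - 2 * q + 2 * ε * a) ≤ q := by nlinarith
    nlinarith
  refine ⟨?_, ?_, ?_, ?_⟩
  · rw [hα]; exact div_nonneg (by linarith) hd.le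
  · rw [hκ]; positivity
  · rw [hκ]; field_simp
    nlinarith [hs2]
  · set κ := q - vulAlpha a ε q with hk
    have h1 : s ≤ 2 * κ := by
      have : κ * (1 + 2 * ε * a) = 2 * (a * ε) * q + s := by rw [hκ]; field_simp
      have hκ0 : 0 < κ := by rw [hκ]; positivity
      nlinarith
    have h2 : s ^ 2 ≤ (2 * κ) ^ 2 := by gcongr
    have h3 : 0 ≤ ε * a * q * (2 * ε * a) := by positivity
    nlinarith

/-- auxiliary distance function of the mesh -/
def vulQ (a ε q t : ℝ) : ℝ := max (q - t) (q - vulAlpha a ε q)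


lemma vulLam_closed {a ε q : ℝ} (hq0 : 0 < q) (hq : q < 1 / 2) (ha : 0 < a) (hε : 0 < ε)
    (haε : a * ε < q) {t : ℝ} (ht : t ≤ 1 - vulAlpha a ε q) :
    vulLam a ε q t = a * ε * (q / vulQ a ε q t - 1)
      + a * ε * q / (q - vulAlpha a ε q) ^ 2 * max (t - vulAlpha a ε q) 0 := by
  obtain ⟨h0, hk, heq, -⟩ := vul_alpha_facts hq0 hq ha hε haε
  simp only [vulLam, vulMu, vulMu', vulQ]
  generalize vulAlpha a ε q = α at *
  by_cases h1 : t ≤ α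
  · rw [if_pos h1, max_eq_left (by linarith), max_eq_right (by linarith)]
    have : q - t ≠ 0 := by linarith
    field_simp; ring
  · rw [if_neg h1]
    push Not at h1
    rw [max_eq_right (by linarith), max_eq_left (by linarith)]
    by_cases h2 : t ≤ 1 / 2
    · rw [if_pos h2]
      field_simp; ring
    · rw [if_neg h2]
      have key : 1 - (a * ε * α / (q - α) + a * ε * q / (q - α) ^ 2 * ((1 - t) - α))
          = a * ε * (q / (q - α) - 1) + a * ε * q / (q - α) ^ 2 * (t - α) := by
        field_simp
        nlinarith [heq]
      by_cases h3 : 1 - t ≤ α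
      · have h4 : 1 - t = α := by linarith
        rw [if_pos h3, ← key, h4]; ring
      · rw [if_neg h3, ← key]

lemma vulLam_reflect_aux {a ε q : ℝ} (hq0 : 0 < q) (hq : q < 1 / 2) (ha : 0 < a) (hε : 0 < ε)
    (haε : a * ε < q) {t : ℝ} (ht : t ≤ 1 / 2) :
    vulLam a ε q (1 - t) = 1 - vulLam a ε q t := by
  obtain ⟨h0, hk, heq, -⟩ := vul_alpha_facts hq0 hq ha hε haε
  rcases ht.lt_or_eq with h | h
  · simp only [vulLam, vulMu, vulMu']
    generalize vulAlpha a ε q = α at *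
    have n1 : ¬ (1 - t ≤ α) := by linarith
    have n2 : ¬ (1 - t ≤ 1 / 2) := by linarith
    rw [if_neg n1, if_neg n2, if_pos ht, sub_sub_cancel]
  · have e : (1:ℝ) - t = t := by linarith
    rw [e, vulLam_closed hq0 hq ha hε haε (by linarith : t ≤ 1 - vulAlpha a ε q)]
    simp only [vulQ]
    generalize vulAlpha a ε q = α at *
    subst h
    rw [max_eq_right (by linarith), max_eq_left (by linarith)]
    field_simp
    nlinarith [heq]

lemma vulLam_reflect {a ε q : ℝ} (hq0 : 0 < q) (hq : q < 1 / 2) (ha : 0 < a) (hε : 0 < ε)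
    (haε : a * ε < q) (t : ℝ) : vulLam a ε q (1 - t) = 1 - vulLam a ε q t := by
  rcases le_total t (1 / 2) with h | h
  · exact vulLam_reflect_aux hq0 hq ha hε haε h
  · have := vulLam_reflect_aux hq0 hq ha hε haε (t := 1 - t) (by linarith)
    rw [sub_sub_cancel] at this
    linarith

lemma vulQ_pos {a ε q : ℝ} (hq0 : 0 < q) (hq : q < 1 / 2) (ha : 0 < a) (hε : 0 < ε)
    (haε : a * ε < q) (t : ℝ) : 0 < vulQ a ε q t := by
  obtain ⟨h0, hk, heq, -⟩ := vul_alpha_facts hq0 hq ha hε haε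
  exact lt_max_of_lt_right hk

/-- gradient inequality -/
lemma vulLam_grad {a ε q : ℝ} (hq0 : 0 < q) (hq : q < 1 / 2) (ha : 0 < a) (hε : 0 < ε)
    (haε : a * ε < q) {s t : ℝ} (hs : s ≤ 1 - vulAlpha a ε q) (ht : t ≤ 1 - vulAlpha a ε q) :
    a * ε * q / vulQ a ε q s ^ 2 * (t - s) ≤ vulLam a ε q t - vulLam a ε q s := by
  have hQs := vulQ_pos hq0 hq ha hε haε s
  have hQt := vulQ_pos hq0 hq ha hε haε t
  obtain ⟨h0, hk, heq, -⟩ := vul_alpha_facts hq0 hq ha hε haε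
  rw [vulLam_closed hq0 hq ha hε haε hs, vulLam_closed hq0 hq ha hε haε ht]
  have et : t = q - vulQ a ε q t + max (t - vulAlpha a ε q) 0 := by
    unfold vulQ
    rcases le_total t (vulAlpha a ε q) with h | h
    · rw [max_eq_left (by linarith), max_eq_right (by linarith)]; ring
    · rw [max_eq_right (by linarith), max_eq_left (by linarith)]; ring
  have es : s = q - vulQ a ε q s + max (s - vulAlpha a ε q) 0 := by
    unfold vulQ
    rcases le_total s (vulAlpha a ε q) with h | h
    · rw [max_eq_left (by linarith), max_eq_right (by linarith)]; ring
    · rw [max_eq_right (by linarith), max_eq_left (by linarith)]; ring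
  have hcross : 0 ≤ (max (t - vulAlpha a ε q) 0 - max (s - vulAlpha a ε q) 0) *
      (1 / (q - vulAlpha a ε q) ^ 2 - 1 / vulQ a ε q s ^ 2) := by
    rcases le_total s (vulAlpha a ε q) with h | h
    · have e1 : max (s - vulAlpha a ε q) 0 = 0 := max_eq_right (by linarith)
      rw [e1, sub_zero]
      refine mul_nonneg (le_max_right _ _) (sub_nonneg.2 ?_)
      have : q - vulAlpha a ε q ≤ vulQ a ε q s := le_max_right _ _
      gcongr
    · have e1 : vulQ a ε q s = q - vulAlpha a ε q := max_eq_right (by linarith)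
      rw [e1]; simp
  have hts : t - s = (vulQ a ε q s - vulQ a ε q t) +
      (max (t - vulAlpha a ε q) 0 - max (s - vulAlpha a ε q) 0) := by linarith
  rw [hts]
  generalize max (t - vulAlpha a ε q) 0 = P at *
  generalize max (s - vulAlpha a ε q) 0 = R at *
  generalize vulQ a ε q s = S at *
  generalize vulQ a ε q t = T at *
  generalize q - vulAlpha a ε q = κ at *
  have e : a * ε * (q / T - 1) + a * ε * q / κ ^ 2 * P - (a * ε * (q / S - 1) + a * ε * q / κ ^ 2 * R)
      - a * ε * q / S ^ 2 * (S - T + (P - R))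
      = a * ε * q * ((S - T) ^ 2 / (T * S ^ 2) + (P - R) * (1 / κ ^ 2 - 1 / S ^ 2)) := by
    field_simp; ring
  have : 0 ≤ a * ε * q * ((S - T) ^ 2 / (T * S ^ 2) + (P - R) * (1 / κ ^ 2 - 1 / S ^ 2)) :=
    mul_nonneg (by positivity) (add_nonneg (by positivity) hcross)
  linarith

lemma vulLam_strictMono_left {a ε q : ℝ} (hq0 : 0 < q) (hq : q < 1 / 2) (ha : 0 < a) (hε : 0 < ε)
    (haε : a * ε < q) : StrictMonoOn (vulLam a ε q) (Iic (1 - vulAlpha a ε q)) := by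
  intro s hs t ht hst
  have := vulLam_grad hq0 hq ha hε haε hs ht
  have hQs := vulQ_pos hq0 hq ha hε haε s
  have h2 : 0 < a * ε * q / vulQ a ε q s ^ 2 * (t - s) :=
    mul_pos (by positivity) (by linarith)
  linarith

lemma vulLam_strictMono {a ε q : ℝ} (hq0 : 0 < q) (hq : q < 1 / 2) (ha : 0 < a) (hε : 0 < ε)
    (haε : a * ε < q) : StrictMono (vulLam a ε q) := by
  obtain ⟨h0, hk, heq, -⟩ := vul_alpha_facts hq0 hq ha hε haε
  have hl := vulLam_strictMono_left hq0 hq ha hε haε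
  have h1 : StrictMonoOn (vulLam a ε q) (Iic (1/2)) := hl.mono (Iic_subset_Iic.2 (by linarith))
  have h2 : StrictMonoOn (vulLam a ε q) (Ici (1/2)) := by
    intro s hs t ht hst
    have hs' : (1/2:ℝ) ≤ s := hs
    have ht' : (1/2:ℝ) ≤ t := ht
    have := hl (show 1 - t ≤ 1 - vulAlpha a ε q by linarith)
      (show 1 - s ≤ 1 - vulAlpha a ε q by linarith) (by linarith)
    rw [vulLam_reflect hq0 hq ha hε haε, vulLam_reflect hq0 hq ha hε haε] at this
    linarith
  exact h1.Iic_union_Ici h2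

lemma vulLam_zero {a ε q : ℝ} (hq0 : 0 < q) (hq : q < 1 / 2) (ha : 0 < a) (hε : 0 < ε)
    (haε : a * ε < q) : vulLam a ε q 0 = 0 := by
  obtain ⟨h0, hk, heq, -⟩ := vul_alpha_facts hq0 hq ha hε haε
  simp [vulLam, vulMu, h0]

lemma vulLam_one {a ε q : ℝ} (hq0 : 0 < q) (hq : q < 1 / 2) (ha : 0 < a) (hε : 0 < ε)
    (haε : a * ε < q) : vulLam a ε q 1 = 1 := by
  have := vulLam_reflect hq0 hq ha hε haε 0
  rw [vulLam_zero hq0 hq ha hε haε] at this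
  simpa using this


lemma exp_layer {c q Q : ℝ} (hc : 0 < c) (hq : 0 < q) (hQ : 0 < Q) :
    Real.exp (-(c * (q / Q - 1))) ≤ Real.exp c * 24 / (c * q) ^ 4 * Q ^ 4 := by
  have h := Real.pow_div_factorial_le_exp (x := c * q / Q) (by positivity) 4
  have e : Real.exp (-(c * (q / Q - 1))) = Real.exp c / Real.exp (c * q / Q) := by
    rw [← Real.exp_sub]; congr 1; ring
  rw [e, div_le_iff₀ (Real.exp_pos _)]
  have h4 : ((Nat.factorial 4 : ℕ) : ℝ) = 24 := by norm_num [Nat.factorial]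
  rw [h4] at h
  calc Real.exp c = Real.exp c * 24 / (c * q) ^ 4 * Q ^ 4 * ((c * q / Q) ^ 4 / 24) := by
        field_simp
    _ ≤ _ := by gcongr

/-- Local mesh properties at three consecutive nodes. -/
def MeshLoc (γ ε δ δ0 K K3 xm x xp : ℝ) : Prop :=
  δ0 ≤ δ ∨ ∃ Q : ℝ, 0 < Q ∧ Q ≤ 1 ∧ ε ≤ K3 * Q ^ 2 ∧
    (∀ z ∈ Icc xm xp, layE γ ε z ≤ K * Q ^ 4) ∧
    (Q ≤ 4 * δ ∨ (xp - x ≤ K * (ε * δ / Q ^ 2) ∧ x - xm ≤ K * (ε * δ / Q ^ 2) ∧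
      |(xp - x) - (x - xm)| ≤ K * (ε * δ ^ 2 / Q ^ 3)))

lemma meshLoc_half {a q γ : ℝ} (hq0 : 0 < q) (hq : q < 1 / 2) (ha : 0 < a) (hγ : 0 < γ) :
    ∃ K K3 : ℝ, 0 < K ∧ 0 < K3 ∧ ∀ ε : ℝ, 0 < ε → a * ε < q → ∀ δ t : ℝ, 0 < δ → δ ≤ t →
      t ≤ 1 / 2 → MeshLoc γ ε δ (1 / 2 - q) K K3
        (vulLam a ε q (t - δ)) (vulLam a ε q t) (vulLam a ε q (t + δ)) := by
  obtain ⟨K1, hK1⟩ : ∃ K1, K1 = Real.exp (γ * a) * 24 / (γ * a * q) ^ 4 := ⟨_, rfl⟩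
  have pK1 : 0 < K1 := by rw [hK1]; positivity
  have hq2 : 0 < 1 - 2 * q := by linarith
  refine ⟨2 * K1 + 16 * (a * q), 4 / (a * q * (1 - 2 * q)), by positivity, by positivity, ?_⟩
  intro ε hε haε δ t hδ hδt ht
  by_cases hbig : 1 / 2 - q ≤ δ
  · exact Or.inl hbig
  right
  push Not at hbig
  have hQp := fun t => vulQ_pos hq0 hq ha hε haε t
  obtain ⟨h0, hk, heq, hεκ⟩ := vul_alpha_facts hq0 hq ha hε haε
  have hmono := vulLam_strictMono hq0 hq ha hε haε
  have hκQ : ∀ t, q - vulAlpha a ε q ≤ vulQ a ε q t := fun t => le_max_right _ _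
  have t1 : t - δ ≤ 1 - vulAlpha a ε q := by linarith
  have t2 : t ≤ 1 - vulAlpha a ε q := by linarith
  have t3 : t + δ ≤ 1 - vulAlpha a ε q := by linarith
  refine ⟨vulQ a ε q (t - δ), hQp _, ?_, ?_, ?_, ?_⟩
  · exact max_le (by linarith) (by linarith)
  · have h1 : (q - vulAlpha a ε q) ^ 2 ≤ vulQ a ε q (t - δ) ^ 2 := by
      gcongr; exact hκQ _
    rw [div_mul_eq_mul_div, le_div_iff₀ (by positivity)]
    linarith
  · intro z hz
    have l1 : Real.exp (-(γ * z / ε)) ≤ K1 * vulQ a ε q (t - δ) ^ 4 := by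
      rw [hK1]
      refine le_trans ?_ (exp_layer (c := γ * a) (by positivity) hq0 (hQp _))
      apply Real.exp_le_exp.2
      have e1 := vulLam_closed hq0 hq ha hε haε t1
      have e2 : 0 ≤ a * ε * q / (q - vulAlpha a ε q) ^ 2 * max (t - δ - vulAlpha a ε q) 0 :=
        mul_nonneg (by positivity) (le_max_right _ _)
      have e3 : a * ε * (q / vulQ a ε q (t - δ) - 1) ≤ z := by linarith [hz.1]
      have e4 : γ * (a * ε * (q / vulQ a ε q (t - δ) - 1)) / ε ≤ γ * z / ε := by gcongr
      have e5 : γ * (a * ε * (q / vulQ a ε q (t - δ) - 1)) / ε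
        = γ * a * (q / vulQ a ε q (t - δ) - 1) := by field_simp
      linarith
    have l2 : Real.exp (-(γ * (1 - z) / ε)) ≤ K1 * vulQ a ε q (t - δ) ^ 4 := by
      have l3 : Real.exp (-(γ * (1 - z) / ε)) ≤ K1 * (q - vulAlpha a ε q) ^ 4 := by
        rw [hK1]
        refine le_trans ?_ (exp_layer (c := γ * a) (by positivity) hq0 hk)
        apply Real.exp_le_exp.2
        have e0 : vulLam a ε q (t + δ) ≤ vulLam a ε q (1 - vulAlpha a ε q) :=
          hmono.monotone t3
        rw [vulLam_reflect hq0 hq ha hε haε, vulLam_closed hq0 hq ha hε haε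
          (by linarith : vulAlpha a ε q ≤ 1 - vulAlpha a ε q)] at e0
        have e1 : vulQ a ε q (vulAlpha a ε q) = q - vulAlpha a ε q := max_self _
        rw [e1, sub_self, max_self, mul_zero, add_zero] at e0
        have e3 : a * ε * (q / (q - vulAlpha a ε q) - 1) ≤ 1 - z := by linarith [hz.2]
        have e4 : γ * (a * ε * (q / (q - vulAlpha a ε q) - 1)) / ε ≤ γ * (1 - z) / ε := by gcongr
        have e5 : γ * (a * ε * (q / (q - vulAlpha a ε q) - 1)) / ε
          = γ * a * (q / (q - vulAlpha a ε q) - 1) := by field_simp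
        linarith
      refine l3.trans ?_
      gcongr
      exact hκQ _
    have p : 0 ≤ 16 * (a * q) * vulQ a ε q (t - δ) ^ 4 := by positivity
    unfold layE
    linarith
  · by_cases hc : vulQ a ε q (t - δ) ≤ 4 * δ
    · exact Or.inl hc
    right
    push Not at hc
    have g1 := vulLam_grad hq0 hq ha hε haε t1 t2
    have g2 := vulLam_grad hq0 hq ha hε haε t2 t1
    have g3 := vulLam_grad hq0 hq ha hε haε t2 t3
    have g4 := vulLam_grad hq0 hq ha hε haε t3 t2
    have m1 : vulLam a ε q (t - δ) < vulLam a ε q t := hmono (by linarith)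
    have m2 : vulLam a ε q t < vulLam a ε q (t + δ) := hmono (by linarith)
    have q1 : vulQ a ε q (t - δ) - 2 * δ ≤ vulQ a ε q (t + δ) := by
      have u1 : q - (t + δ) ≤ vulQ a ε q (t + δ) := le_max_left _ _
      have u2 := hκQ (t + δ)
      have : vulQ a ε q (t - δ) ≤ vulQ a ε q (t + δ) + 2 * δ :=
        max_le (by linarith) (by linarith)
      linarith
    have q2 : vulQ a ε q (t + δ) ≤ vulQ a ε q t := max_le_max (by linarith) le_rfl
    have q3 : vulQ a ε q t ≤ vulQ a ε q (t - δ) := max_le_max (by linarith) le_rfl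
    have pm := hQp (t - δ)
    have p0 := hQp t
    have pp := hQp (t + δ)
    generalize vulQ a ε q (t - δ) = Qm at *
    generalize vulQ a ε q (t + δ) = Qp at *
    generalize vulQ a ε q t = Q0 at *
    generalize vulLam a ε q (t - δ) = xm at *
    generalize vulLam a ε q (t + δ) = xp at *
    generalize vulLam a ε q t = x at *
    have hQ2 : Qm / 2 ≤ Qp := by linarith
    have aeq : 0 < a * ε * q := by positivity
    have r1 : a * ε * q / Q0 ^ 2 * δ ≤ a * ε * q / Qp ^ 2 * δ := by gcongr
    have r2 : a * ε * q / Qp ^ 2 * δ ≤ a * ε * q / (Qm / 2) ^ 2 * δ := by gcongr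
    have r3 : a * ε * q / (Qm / 2) ^ 2 * δ = 4 * (a * q) * (ε * δ / Qm ^ 2) := by
      field_simp; ring
    have r4 : 4 * (a * q) * (ε * δ / Qm ^ 2) ≤ (2 * K1 + 16 * (a * q)) * (ε * δ / Qm ^ 2) := by
      have : 0 < a * q := by positivity
      gcongr
      linarith
    refine ⟨by linarith, by linarith, ?_⟩
    have nn : 0 ≤ (xp - x) - (x - xm) := by linarith
    rw [abs_of_nonneg nn]
    have d1 : (xp - x) - (x - xm) ≤ a * ε * q * δ * (1 / Qp ^ 2 - 1 / Qm ^ 2) := by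
      have : a * ε * q * δ * (1 / Qp ^ 2 - 1 / Qm ^ 2)
        = a * ε * q / Qp ^ 2 * δ - a * ε * q / Qm ^ 2 * δ := by ring
      linarith
    have d2 : 1 / Qp ^ 2 - 1 / Qm ^ 2 ≤ 16 * δ / Qm ^ 3 := by
      have e : 1 / Qp ^ 2 - 1 / Qm ^ 2 = (Qm - Qp) * (Qm + Qp) / (Qp ^ 2 * Qm ^ 2) := by
        field_simp; ring
      rw [e]
      calc (Qm - Qp) * (Qm + Qp) / (Qp ^ 2 * Qm ^ 2)
          ≤ (2 * δ) * (2 * Qm) / ((Qm / 2) ^ 2 * Qm ^ 2) := by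
            gcongr
            · linarith
            · linarith
        _ = 16 * δ / Qm ^ 3 := by field_simp; ring
    calc (xp - x) - (x - xm) ≤ a * ε * q * δ * (1 / Qp ^ 2 - 1 / Qm ^ 2) := d1
      _ ≤ a * ε * q * δ * (16 * δ / Qm ^ 3) := by gcongr
      _ = 16 * (a * q) * (ε * δ ^ 2 / Qm ^ 3) := by ring
      _ ≤ _ := by
        gcongr
        linarith

lemma layE_symm (γ ε z : ℝ) : layE γ ε (1 - z) = layE γ ε z := by
  unfold layE; rw [sub_sub_cancel, add_comm]

lemma MeshLoc.reflect {γ ε δ δ0 K K3 xm x xp : ℝ} (h : MeshLoc γ ε δ δ0 K K3 xm x xp) :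
    MeshLoc γ ε δ δ0 K K3 (1 - xp) (1 - x) (1 - xm) := by
  rcases h with h | ⟨Q, h1, h1', h2, h3, h4⟩
  · exact Or.inl h
  refine Or.inr ⟨Q, h1, h1', h2, fun z hz => ?_, ?_⟩
  · rw [← layE_symm]; exact h3 _ ⟨by linarith [hz.2], by linarith [hz.1]⟩
  · rcases h4 with h4 | ⟨a1, a2, a3⟩
    · exact Or.inl h4
    · refine Or.inr ⟨by linarith, by linarith, ?_⟩
      rw [← abs_neg]
      convert a3 using 2
      ring

lemma meshLoc_all {a q γ : ℝ} (hq0 : 0 < q) (hq : q < 1 / 2) (ha : 0 < a) (hγ : 0 < γ) :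
    ∃ K K3 : ℝ, 0 < K ∧ 0 < K3 ∧ ∀ ε : ℝ, 0 < ε → a * ε < q → ∀ δ t : ℝ, 0 < δ → δ ≤ t →
      t ≤ 1 - δ → MeshLoc γ ε δ (1 / 2 - q) K K3
        (vulLam a ε q (t - δ)) (vulLam a ε q t) (vulLam a ε q (t + δ)) := by
  obtain ⟨K, K3, hK, hK3, H⟩ := meshLoc_half hq0 hq ha hγ
  refine ⟨K, K3, hK, hK3, fun ε hε haε δ t hδ hδt ht => ?_⟩
  rcases le_total t (1 / 2) with h | h
  · exact H ε hε haε δ t hδ hδt h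
  · have := (H ε hε haε δ (1 - t) hδ (by linarith) (by linarith)).reflect
    rw [← vulLam_reflect hq0 hq ha hε haε, ← vulLam_reflect hq0 hq ha hε haε,
      ← vulLam_reflect hq0 hq ha hε haε] at this
    have e1 : 1 - (1 - t + δ) = t - δ := by ring
    have e2 : 1 - (1 - t - δ) = t + δ := by ring
    rwa [e1, e2, sub_sub_cancel] at this

lemma disc_max {ε β T : ℝ} (hβ : 0 < β) (hT : 0 ≤ T) {n : ℕ} {x e c : ℕ → ℝ}
    (hx : ∀ i < n, x i < x (i + 1)) (hc : ∀ i ≤ n, β ≤ c i)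
    (h : ∀ i, 1 ≤ i → i < n → -ε ^ 2 * ddiff x e i + c i * e i ≤ T)
    (h0 : e 0 = 0) (hn : e n = 0) : ∀ i ≤ n, e i ≤ T / β := by
  obtain ⟨m, hm, hmax⟩ := Finset.exists_max_image (Finset.range (n + 1)) e ⟨0, by simp⟩
  have hm' : m ≤ n := by simpa [Nat.lt_succ_iff] using hm
  have hmax' : ∀ i ≤ n, e i ≤ e m := fun i hi => hmax i (by simp; omega)
  intro i hi
  refine (hmax' i hi).trans ?_
  have hTβ : 0 ≤ T / β := by positivity
  by_cases hm0 : e m ≤ 0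
  · exact hm0.trans hTβ
  push Not at hm0
  have m1 : 1 ≤ m := by
    rcases Nat.eq_zero_or_pos m with h' | h'
    · rw [h', h0] at hm0; exact absurd hm0 (lt_irrefl _)
    · exact h'
  have m2 : m < n := by
    rcases hm'.lt_or_eq with h' | h'
    · exact h'
    · rw [h', hn] at hm0; exact absurd hm0 (lt_irrefl _)
  have hk := h m m1 m2
  have x1 : x m < x (m + 1) := hx m m2
  have x2 : x (m - 1) < x m := by
    have := hx (m - 1) (by omega)
    rwa [Nat.sub_add_cancel m1] at this
  have hdd : ddiff x e m ≤ 0 := by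
    unfold ddiff
    have a1 : (e (m + 1) - e m) / (x (m + 1) - x m) ≤ 0 :=
      div_nonpos_of_nonpos_of_nonneg (by linarith [hmax' (m + 1) (by omega)]) (by linarith)
    have a2 : 0 ≤ (e m - e (m - 1)) / (x m - x (m - 1)) :=
      div_nonneg (by linarith [hmax' (m - 1) (by omega)]) (by linarith)
    have a3 : 0 ≤ 2 / (x (m + 1) - x (m - 1)) := div_nonneg (by norm_num) (by linarith)
    exact mul_nonpos_of_nonneg_of_nonpos a3 (by linarith)
  have : 0 ≤ -ε ^ 2 * ddiff x e m := by nlinarith [sq_nonneg ε]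
  have hcm := hc m hm'
  rw [le_div_iff₀ hβ]
  nlinarith

lemma ddiff_sub (x e f : ℕ → ℝ) (i : ℕ) :
    ddiff x (fun j => e j - f j) i = ddiff x e i - ddiff x f i := by
  unfold ddiff; ring

lemma ddiff_neg (x e : ℕ → ℝ) (i : ℕ) :
    ddiff x (fun j => - e j) i = - ddiff x e i := by
  unfold ddiff; ring

lemma disc_stab {ε β T : ℝ} (hβ : 0 < β) (hT : 0 ≤ T) {n : ℕ} {x e c : ℕ → ℝ}
    (hx : ∀ i < n, x i < x (i + 1)) (hc : ∀ i ≤ n, β ≤ c i)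
    (h : ∀ i, 1 ≤ i → i < n → |-ε ^ 2 * ddiff x e i + c i * e i| ≤ T)
    (h0 : e 0 = 0) (hn : e n = 0) : ∀ i ≤ n, |e i| ≤ T / β := by
  intro i hi
  have a1 := disc_max hβ hT hx hc (fun i h1 h2 => (abs_le.1 (h i h1 h2)).2) h0 hn i hi
  have a2 := disc_max (ε := ε) (e := fun j => - e j) hβ hT hx hc
    (fun i h1 h2 => by rw [ddiff_neg]; linarith [(abs_le.1 (h i h1 h2)).1])
    (by simp [h0]) (by simp [hn]) i hi
  exact abs_le.2 ⟨by linarith, a1⟩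

lemma disc_unique {bc gc : ℝ → ℝ} {ε β : ℝ} (hβ : 0 < β) {n : ℕ} {x : ℕ → ℝ}
    (hx : ∀ i < n, x i < x (i + 1)) (hc : ∀ i ≤ n, β ≤ bc (x i)) {y y' : ℕ → ℝ}
    (hy : LinScheme bc gc ε x n y) (hy' : LinScheme bc gc ε x n y') : ∀ i ≤ n, y i = y' i := by
  intro i hi
  have := disc_stab (ε := ε) (T := 0) (e := fun j => y j - y' j) (c := fun j => bc (x j)) hβ le_rfl
    hx hc (fun i h1 h2 => by
      rw [ddiff_sub]
      have e1 := hy.1 i h1 h2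
      have e2 := hy'.1 i h1 h2
      have : -ε ^ 2 * (ddiff x y i - ddiff x y' i) + bc (x i) * (y i - y' i) = 0 := by linarith
      rw [this]; simp)
    (by simp [hy.2.1, hy'.2.1]) (by simp [hy.2.2, hy'.2.2]) i hi
  rw [zero_div] at this
  have := abs_nonpos_iff.1 this
  linarith

/-- extension of a finite vector by zero -/
def extV (n : ℕ) (y : Fin (n + 1) → ℝ) (j : ℕ) : ℝ := if h : j < n + 1 then y ⟨j, h⟩ else 0

lemma extV_add (n : ℕ) (y z : Fin (n + 1) → ℝ) (j : ℕ) :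
    extV n (y + z) j = extV n y j + extV n z j := by
  unfold extV; split <;> simp

lemma extV_smul (n : ℕ) (c : ℝ) (y : Fin (n + 1) → ℝ) (j : ℕ) :
    extV n (c • y) j = c * extV n y j := by
  unfold extV; split <;> simp

/-- the discrete operator -/
def discL (bc : ℝ → ℝ) (ε : ℝ) (x : ℕ → ℝ) (n : ℕ) :
    (Fin (n + 1) → ℝ) →ₗ[ℝ] (Fin (n + 1) → ℝ) where
  toFun y i := if (i : ℕ) = 0 ∨ (i : ℕ) = n then extV n y i else
    -ε ^ 2 * ddiff x (extV n y) i + bc (x i) * extV n y i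
  map_add' y z := by
    funext i
    simp only [Pi.add_apply]
    split
    · exact extV_add _ _ _ _
    · simp only [ddiff, extV_add]; ring
  map_smul' c y := by
    funext i
    simp only [Pi.smul_apply, smul_eq_mul, RingHom.id_apply]
    split
    · exact extV_smul _ _ _ _
    · simp only [ddiff, extV_smul]; ring

lemma disc_exists {bc gc : ℝ → ℝ} {ε β : ℝ} (hβ : 0 < β) {n : ℕ} {x : ℕ → ℝ}
    (hx : ∀ i < n, x i < x (i + 1)) (hc : ∀ i ≤ n, β ≤ bc (x i)) :
    ∃ y : ℕ → ℝ, LinScheme bc gc ε x n y := by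
  have hval : ∀ (y : Fin (n + 1) → ℝ) (i : Fin (n + 1)), discL bc ε x n y i =
    if (i : ℕ) = 0 ∨ (i : ℕ) = n then extV n y i else
    -ε ^ 2 * ddiff x (extV n y) i + bc (x i) * extV n y i := fun y i => rfl
  have hinj : Function.Injective (discL bc ε x n) := by
    rw [injective_iff_map_eq_zero]
    intro y hy
    have hs : LinScheme bc (fun _ => 0) ε x n (extV n y) := by
      refine ⟨fun i h1 h2 => ?_, ?_, ?_⟩
      · have := congrFun hy ⟨i, by omega⟩
        rw [hval, if_neg (by simp only; omega)] at this
        simpa using this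
      · have := congrFun hy ⟨0, by omega⟩
        rw [hval, if_pos (by simp)] at this
        simpa using this
      · have := congrFun hy ⟨n, by omega⟩
        rw [hval, if_pos (by simp)] at this
        simpa using this
    have hz : LinScheme bc (fun _ => 0) ε x n (fun _ => 0) := by
      refine ⟨fun i h1 h2 => ?_, rfl, rfl⟩
      simp [ddiff]
    funext i
    have := disc_unique hβ hx hc hs hz i (by omega)
    simpa [extV, i.is_le] using this
  have hsurj : Function.Surjective (discL bc ε x n) := LinearMap.injective_iff_surjective.1 hinj
  obtain ⟨y, hy⟩ := hsurj (fun i => if (i : ℕ) = 0 ∨ (i : ℕ) = n then 0 else gc (x i))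
  refine ⟨extV n y, fun i h1 h2 => ?_, ?_, ?_⟩
  · have := congrFun hy ⟨i, by omega⟩
    rw [hval, if_neg (by simp only; omega)] at this
    simp only [if_neg (by omega : ¬ (i = 0 ∨ i = n))] at this
    exact this
  · have := congrFun hy ⟨0, by omega⟩
    rw [hval, if_pos (by simp)] at this
    simpa using this
  · have := congrFun hy ⟨n, by omega⟩
    rw [hval, if_pos (by simp)] at this
    simpa using this

lemma trunc_bound {γ ε δ δ0 K Km K3 xm x xp : ℝ} {u u1 u2 u3 u4 : ℝ → ℝ}
    (hγ : 0 ≤ γ) (hε : 0 < ε) (hε1 : ε ≤ 1) (hδ : 0 < δ) (hδ0 : 0 < δ0)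
    (hK : 0 < K) (hKm : 0 < Km) (hK3 : 0 < K3)
    (hxm : 0 ≤ xm) (hxp : xp ≤ 1) (hm : xm < x) (hp : x < xp)
    (h1 : ∀ z ∈ Icc (0:ℝ) 1, HasDerivWithinAt u (u1 z) (Icc 0 1) z)
    (h2 : ∀ z ∈ Icc (0:ℝ) 1, HasDerivWithinAt u1 (u2 z) (Icc 0 1) z)
    (h3 : ∀ z ∈ Icc (0:ℝ) 1, HasDerivWithinAt u2 (u3 z) (Icc 0 1) z)
    (h4 : ∀ z ∈ Icc (0:ℝ) 1, HasDerivWithinAt u3 (u4 z) (Icc 0 1) z)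
    (b2 : ∀ x ∈ Icc (0:ℝ) 1, ε ^ 2 * |u2 x| ≤ K * (ε ^ 2 + layE γ ε x))
    (b3 : ∀ x ∈ Icc (0:ℝ) 1, ε ^ 2 * |u3 x| ≤ K * (ε + layE γ ε x / ε))
    (b4 : ∀ x ∈ Icc (0:ℝ) 1, ε ^ 2 * |u4 x| ≤ K * (1 + layE γ ε x / ε ^ 2))
    (hloc : MeshLoc γ ε δ δ0 Km K3 xm x xp) :
    ε ^ 2 * |dd3 xm x xp (u xm) (u x) (u xp) - u2 x| ≤
      (9 * K / δ0 ^ 2 + (48 * K + Km * K + 4 * K * Km ^ 2) * (K3 ^ 2 + Km)) * δ ^ 2 := by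
  have pε : 0 < ε ^ 2 := by positivity
  have hsub : ∀ z ∈ Icc xm xp, z ∈ Icc (0:ℝ) 1 := fun z hz =>
    ⟨by linarith [hz.1], by linarith [hz.2]⟩
  have hxx : x ∈ Icc xm xp := ⟨hm.le, hp.le⟩
  have P1 : 0 < 9 * K / δ0 ^ 2 * δ ^ 2 := by positivity
  have P2 : 0 < 48 * K * (K3 ^ 2 + Km) * δ ^ 2 := by positivity
  have P3 : 0 < Km * K * (K3 ^ 2 + Km) * δ ^ 2 := by positivity
  have P4 : 0 < 4 * K * Km ^ 2 * (K3 ^ 2 + Km) * δ ^ 2 := by positivity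
  rcases hloc with hl | ⟨Q, hQ, hQ1, hεQ, hE, hl⟩
  · have := dd3_bound1 hxm hxp hm hp h1 h2 (S := 3 * K / ε ^ 2) (fun z hz => by
      rw [le_div_iff₀ pε]
      have a1 := b2 z (hsub z hz)
      have a2 := layE_le_two hγ hε (hsub z hz)
      have a3 : K * (ε ^ 2 + layE γ ε z) ≤ K * 3 := by gcongr; nlinarith
      linarith)
    have e : ε ^ 2 * |dd3 xm x xp (u xm) (u x) (u xp) - u2 x| ≤ 9 * K := by
      calc _ ≤ ε ^ 2 * (3 * (3 * K / ε ^ 2)) := by gcongr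
        _ = 9 * K := by field_simp; ring
    have e2 : 9 * K ≤ 9 * K / δ0 ^ 2 * δ ^ 2 := by
      calc 9 * K = 9 * K / δ0 ^ 2 * δ0 ^ 2 := by field_simp
        _ ≤ _ := by gcongr
    linarith
  have hε2 : ε ^ 2 ≤ K3 ^ 2 * Q ^ 4 := by
    calc ε ^ 2 ≤ (K3 * Q ^ 2) ^ 2 := by gcongr
      _ = _ := by ring
  rcases hl with hl | ⟨l1, l2, l3⟩
  · have := dd3_bound1 hxm hxp hm hp h1 h2 (S := K * ((K3 ^ 2 + Km) * Q ^ 4) / ε ^ 2)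
      (fun z hz => by
      rw [le_div_iff₀ pε]
      have a1 := b2 z (hsub z hz)
      have a2 := hE z hz
      have a3 : K * (ε ^ 2 + layE γ ε z) ≤ K * ((K3 ^ 2 + Km) * Q ^ 4) := by gcongr; linarith
      linarith)
    have e : ε ^ 2 * |dd3 xm x xp (u xm) (u x) (u xp) - u2 x|
        ≤ 3 * K * (K3 ^ 2 + Km) * Q ^ 4 := by
      calc _ ≤ ε ^ 2 * (3 * (K * ((K3 ^ 2 + Km) * Q ^ 4) / ε ^ 2)) := by gcongr
        _ = _ := by field_simp
    have e2 : Q ^ 4 ≤ 16 * δ ^ 2 := by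
      have s1 : Q ^ 2 ≤ (4 * δ) ^ 2 := by gcongr
      have s2 : Q ^ 2 ≤ 1 := pow_le_one₀ hQ.le hQ1
      nlinarith [sq_nonneg Q]
    have e3 : 3 * K * (K3 ^ 2 + Km) * Q ^ 4 ≤ 3 * K * (K3 ^ 2 + Km) * (16 * δ ^ 2) := by gcongr
    linarith
  · have := dd3_bound2 hxm hxp hm hp h1 h2 h3 h4 (S := K * (1 + Km * Q ^ 4 / ε ^ 2) / ε ^ 2)
      (fun z hz => by
      rw [le_div_iff₀ pε]
      have a1 := b4 z (hsub z hz)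
      have a2 := hE z hz
      have a3 : K * (1 + layE γ ε z / ε ^ 2) ≤ K * (1 + Km * Q ^ 4 / ε ^ 2) := by gcongr
      linarith)
    have c3 : ε ^ 2 * |u3 x| ≤ K * (ε + Km * Q ^ 4 / ε) := by
      refine (b3 x (hsub x hxx)).trans ?_
      have a2 := hE x hxx
      gcongr
    have hεQ4 : ε ^ 2 / Q ^ 4 ≤ K3 ^ 2 := by rw [div_le_iff₀ (by positivity)]; exact hε2
    have f1 : ε ^ 2 * (|(xp - x) - (x - xm)| * |u3 x|)
        ≤ Km * K * (K3 ^ 2 + Km) * δ ^ 2 := by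
      calc ε ^ 2 * (|(xp - x) - (x - xm)| * |u3 x|)
          = |(xp - x) - (x - xm)| * (ε ^ 2 * |u3 x|) := by ring
        _ ≤ Km * (ε * δ ^ 2 / Q ^ 3) * (K * (ε + Km * Q ^ 4 / ε)) := by gcongr
        _ = Km * K * (ε ^ 2 / Q ^ 4 * Q + Km * Q) * δ ^ 2 := by field_simp
        _ ≤ Km * K * (K3 ^ 2 * 1 + Km * 1) * δ ^ 2 := by gcongr
        _ = _ := by ring
    have hp0 : 0 < xp - x := by linarith
    have hm0 : 0 < x - xm := by linarith
    have f2 : ε ^ 2 * (2 * (K * (1 + Km * Q ^ 4 / ε ^ 2) / ε ^ 2) * ((xp - x) ^ 2 + (x - xm) ^ 2))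
        ≤ 4 * K * Km ^ 2 * (K3 ^ 2 + Km) * δ ^ 2 := by
      calc _ ≤ ε ^ 2 * (2 * (K * (1 + Km * Q ^ 4 / ε ^ 2) / ε ^ 2)
            * ((Km * (ε * δ / Q ^ 2)) ^ 2 + (Km * (ε * δ / Q ^ 2)) ^ 2)) := by gcongr
        _ = 4 * K * Km ^ 2 * (ε ^ 2 / Q ^ 4 + Km) * δ ^ 2 := by field_simp; ring
        _ ≤ _ := by gcongr
    have f3 : ε ^ 2 * |dd3 xm x xp (u xm) (u x) (u xp) - u2 x| ≤
        ε ^ 2 * (|(xp - x) - (x - xm)| * |u3 x| +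
          2 * (K * (1 + Km * Q ^ 4 / ε ^ 2) / ε ^ 2) * ((xp - x) ^ 2 + (x - xm) ^ 2)) := by gcongr
    rw [mul_add] at f3
    linarith

lemma iter_deriv {f : ℝ → ℝ} {N k : ℕ} (hf : ContDiffOn ℝ N f (Icc (0:ℝ) 1)) (hk : k < N) :
    ∀ x ∈ Icc (0:ℝ) 1, HasDerivWithinAt (iteratedDerivWithin k f (Icc (0:ℝ) 1))
      (iteratedDerivWithin (k + 1) f (Icc (0:ℝ) 1) x) (Icc 0 1) x := by
  intro x hx
  have h := hf.differentiableOn_iteratedDerivWithin (m := k) (by exact_mod_cast hk)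
    (uniqueDiffOn_Icc zero_lt_one)
  rw [iteratedDerivWithin_succ]
  exact (h x hx).hasDerivWithinAt

/-- ε-uniform second-order convergence of the discrete scheme for
the linear problem on the Vulanović mesh. -/
theorem stmt_9 (b g : ℝ → ℝ → ℝ) (β : ℝ) (hβ : 0 < β)
    (hb : UnifC3 b) (hg : UnifC3 g)
    (hbβ : ∀ x ∈ Icc (0:ℝ) 1, ∀ ε ∈ Icc (0:ℝ) 1, β ≤ b x ε)
    (q a : ℝ) (hq : q ∈ Ioo (0:ℝ) (1/2)) (ha : 0 < a)
    (haβ : 2 ≤ a * Real.sqrt β) :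
    ∃ C : ℝ, 0 < C ∧
      ∀ ε ∈ Ioc (0:ℝ) 1, a * ε < q → ∀ n : ℕ, 2 ≤ n →
      ∀ u : ℝ → ℝ,
        IsLinSolution (fun x => b x ε) (fun x => g x ε) ε u →
        (∃ y : ℕ → ℝ, LinScheme (fun x => b x ε) (fun x => g x ε) ε
            (vulMesh a ε q n) n y) ∧
        (∀ y y' : ℕ → ℝ,
          LinScheme (fun x => b x ε) (fun x => g x ε) ε (vulMesh a ε q n) n y →
          LinScheme (fun x => b x ε) (fun x => g x ε) ε (vulMesh a ε q n) n y' →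
          ∀ i ≤ n, y i = y' i) ∧
        (∀ y : ℕ → ℝ,
          LinScheme (fun x => b x ε) (fun x => g x ε) ε (vulMesh a ε q n) n y →
          ∀ i ≤ n,
            |u (vulMesh a ε q n i) - y i| ≤ C * ((n:ℝ) ^ 2)⁻¹) := by
  have hq0 := hq.1
  have hq1 := hq.2
  obtain ⟨γ, hγd⟩ : ∃ γ, γ = Real.sqrt β := ⟨_, rfl⟩
  have hγ : 0 < γ := by rw [hγd]; exact Real.sqrt_pos.2 hβ
  have hγ2 : γ ^ 2 = β := by rw [hγd]; exact Real.sq_sqrt hβ.le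
  obtain ⟨Mb, hMb⟩ := hb
  obtain ⟨Mg, hMg⟩ := hg
  obtain ⟨M, hMd⟩ : ∃ M, M = max (max Mb Mg) 0 := ⟨_, rfl⟩
  have hM0 : 0 ≤ M := by rw [hMd]; exact le_max_right _ _
  have hMbM : Mb ≤ M := by rw [hMd]; exact (le_max_left _ _).trans (le_max_left _ _)
  have hMgM : Mg ≤ M := by rw [hMd]; exact (le_max_right _ _).trans (le_max_left _ _)
  obtain ⟨K, hK, HK⟩ := deriv_bounds hβ hγ.le hγ2 hM0
  obtain ⟨Km, K3, hKm, hK3, Hmesh⟩ := meshLoc_all hq0 hq1 ha hγ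
  have hδ0 : 0 < 1 / 2 - q := by linarith
  obtain ⟨C0, hC0⟩ : ∃ C0, C0 = 9 * K / (1 / 2 - q) ^ 2
    + (48 * K + Km * K + 4 * K * Km ^ 2) * (K3 ^ 2 + Km) := ⟨_, rfl⟩
  have pC0 : 0 < C0 := by rw [hC0]; positivity
  refine ⟨C0 / β, by positivity, ?_⟩
  intro ε hε haε n hn u hu
  have hε0 := hε.1
  have hε1 := hε.2
  have hεI : ε ∈ Icc (0:ℝ) 1 := ⟨hε0.le, hε1⟩
  have hmono := vulLam_strictMono hq0 hq1 ha hε0 haε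
  have hnpos : (0:ℝ) < n := by exact_mod_cast (by omega : 0 < n)
  have hmeshlt : ∀ i < n, vulMesh a ε q n i < vulMesh a ε q n (i + 1) := by
    intro i _
    apply hmono
    push_cast
    gcongr
    linarith
  have hmeshI : ∀ i ≤ n, vulMesh a ε q n i ∈ Icc (0:ℝ) 1 := by
    intro i hi
    have hi' : (i:ℝ) ≤ n := by exact_mod_cast hi
    constructor
    · rw [← vulLam_zero hq0 hq1 ha hε0 haε]
      exact hmono.monotone (by positivity)
    · rw [← vulLam_one hq0 hq1 ha hε0 haε]
      exact hmono.monotone ((div_le_one hnpos).2 hi')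
  have hc : ∀ i ≤ n, β ≤ b (vulMesh a ε q n i) ε := fun i hi => hbβ _ (hmeshI i hi) ε hεI
  refine ⟨disc_exists (bc := fun x => b x ε) hβ hmeshlt hc,
    fun y y' hy hy' => disc_unique (bc := fun x => b x ε) hβ hmeshlt hc hy hy', ?_⟩
  intro y hy
  obtain ⟨huC, hueq, hu0, hu1⟩ := hu
  obtain ⟨hbC, hbM⟩ := hMb ε hεI
  obtain ⟨hgC, hgM⟩ := hMg ε hεI
  have hbC' : ContDiffOn ℝ ((3:ℕ)) (fun x => b x ε) (Icc (0:ℝ) 1) := by exact_mod_cast hbC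
  have hgC' : ContDiffOn ℝ ((3:ℕ)) (fun x => g x ε) (Icc (0:ℝ) 1) := by exact_mod_cast hgC
  have huC' : ContDiffOn ℝ ((2:ℕ)) u (Icc (0:ℝ) 1) := by exact_mod_cast huC
  have db0 := iter_deriv hbC' (by norm_num : 0 < 3)
  have db1 := iter_deriv hbC' (by norm_num : 1 < 3)
  have dg0 := iter_deriv hgC' (by norm_num : 0 < 3)
  have dg1 := iter_deriv hgC' (by norm_num : 1 < 3)
  have du0 := iter_deriv huC' (by norm_num : 0 < 2)
  have du1 := iter_deriv huC' (by norm_num : 1 < 2)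
  rw [iteratedDerivWithin_zero] at db0 dg0 du0
  have ueq : ∀ x ∈ Icc (0:ℝ) 1, ε ^ 2 * iteratedDerivWithin 2 u (Icc (0:ℝ) 1) x
      = b x ε * u x - g x ε := by
    have c2 : ContinuousOn (iteratedDerivWithin 2 u (Icc (0:ℝ) 1)) (Icc 0 1) :=
      huC'.continuousOn_iteratedDerivWithin (by norm_num) (uniqueDiffOn_Icc zero_lt_one)
    have key : EqOn (fun x => ε ^ 2 * iteratedDerivWithin 2 u (Icc (0:ℝ) 1) x)
        (fun x => b x ε * u x - g x ε) (Ioo 0 1) := by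
      intro x hx
      have := hueq x hx
      simp only at this ⊢
      linarith
    refine key.of_subset_closure (continuousOn_const.mul c2)
      ((hbC.continuousOn.mul huC.continuousOn).sub hgC.continuousOn) Ioo_subset_Icc_self ?_
    rw [closure_Ioo zero_ne_one]
  obtain ⟨u3, u4, d2, d3, B2, B3, B4⟩ := HK ε hε0 hε1 _ _ _ _ _ _ _ _ _ db0 db1 dg0 dg1 du0 du1
    (fun x hx => ⟨by simpa using (hbM 0 (by norm_num) x hx).trans hMbM,
      (hbM 1 (by norm_num) x hx).trans hMbM, (hbM 2 (by norm_num) x hx).trans hMbM⟩)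
    (fun x hx => ⟨by simpa using (hgM 0 (by norm_num) x hx).trans hMgM,
      (hgM 1 (by norm_num) x hx).trans hMgM, (hgM 2 (by norm_num) x hx).trans hMgM⟩)
    (fun x hx => hbβ x hx ε hεI) ueq hu0 hu1
  obtain ⟨δ, hδd⟩ : ∃ δ : ℝ, δ = 1 / n := ⟨_, rfl⟩
  have hδ : 0 < δ := by rw [hδd]; positivity
  have hfin := disc_stab (ε := ε) (T := C0 * δ ^ 2) (x := vulMesh a ε q n)
    (e := fun j => u (vulMesh a ε q n j) - y j)
    (c := fun j => b (vulMesh a ε q n j) ε) hβ (by positivity) hmeshlt hc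
    (fun i h1 h2 => by
      have hi1 : (1:ℝ) ≤ i := by exact_mod_cast h1
      have hi2 : (i:ℝ) + 1 ≤ n := by exact_mod_cast h2
      have em : vulMesh a ε q n (i - 1) = vulLam a ε q ((i:ℝ) / n - δ) := by
        unfold vulMesh; rw [Nat.cast_sub h1, hδd]; congr 1; push_cast; ring
      have ep : vulMesh a ε q n (i + 1) = vulLam a ε q ((i:ℝ) / n + δ) := by
        unfold vulMesh; rw [hδd]; congr 1; push_cast; ring
      have hloc := Hmesh ε hε0 haε δ ((i:ℝ) / n) hδ
        (by rw [hδd]; gcongr) (by rw [hδd, le_sub_iff_add_le, ← add_div, div_le_one hnpos]; exact hi2)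
      rw [← em, ← ep] at hloc
      change MeshLoc _ _ _ _ _ _ _ (vulMesh a ε q n i) _ at hloc
      have hlt2 := hmeshlt i h2
      have hlt1 : vulMesh a ε q n (i - 1) < vulMesh a ε q n i := by
        have := hmeshlt (i - 1) (by omega)
        rwa [Nat.sub_add_cancel h1] at this
      have tb := trunc_bound hγ.le hε0 hε1 hδ hδ0 hK hKm hK3 (hmeshI (i - 1) (by omega)).1
        (hmeshI (i + 1) (by omega)).2 hlt1 hlt2 du0 du1 d2 d3 B2 B3 B4 hloc
      rw [← hC0] at tb
      refine le_trans (le_of_eq ?_) tb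
      rw [ddiff_sub]
      have s1 := hy.1 i h1 h2
      have s2 := ueq _ (hmeshI i h2.le)
      have s3 : ddiff (vulMesh a ε q n) (fun j => u (vulMesh a ε q n j)) i
        = dd3 (vulMesh a ε q n (i - 1)) (vulMesh a ε q n i) (vulMesh a ε q n (i + 1))
          (u (vulMesh a ε q n (i - 1))) (u (vulMesh a ε q n i)) (u (vulMesh a ε q n (i + 1))) := rfl
      rw [s3]
      simp only at s1
      rw [← abs_of_pos (by positivity : 0 < ε ^ 2), ← abs_mul, abs_of_pos (by positivity : 0 < ε ^ 2),
        ← abs_neg]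
      congr 1
      linarith)
    (by
      have : vulMesh a ε q n 0 = 0 := by
        unfold vulMesh; simpa using vulLam_zero hq0 hq1 ha hε0 haε
      simp [this, hu0, hy.2.1])
    (by
      have : vulMesh a ε q n n = 1 := by
        unfold vulMesh; rw [div_self hnpos.ne']; exact vulLam_one hq0 hq1 ha hε0 haε
      simp [this, hu1, hy.2.2])
  intro i hi
  refine (hfin i hi).trans (le_of_eq ?_)
  rw [hδd]; field_simp
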